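/- arXiv:1103.2459 — 3 statements merged into one kernel-verified Lean document; each statement's English description precedes it below -/
import Mathlib

section
/- Let R be a commutative Noetherian regular local ring and let I ⊆ R be an ideal all of whose minimal primes have height at least 2. Then the following are equivalent: (1) every associated prime of R/I has height exactly 2 (i.e., the subscheme defined by I is of pure codimension 2); (2) for every integer p ≥ 3, every prime ideal in the support of Ext^p_R(R/I, R) has height strictly greater than p. -/
open CategoryTheory

/-- The `n`-th Ext group of the `R`-modules `M` and `N`. -/
noncomputable def ExtGrp (R : Type) [CommRing R] (M N : ModuleCat R) (n : ℕ) : ModuleCat R :=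
  ((Ext R (ModuleCat R) n).obj (Opposite.op M)).obj N

namespace PureCodim

/-- Local vanishing at `q` of `Ext^n(M, Y)`. -/
def LV {R : Type} [CommRing R] (Y : ModuleCat.{0} R) (n : ℕ) (q : Ideal R) (M : ModuleCat.{0} R) :
    Prop :=
  ∀ e : Abelian.Ext.{0} M Y n, ∃ s : R, s ∉ q ∧ s • e = 0

theorem ext_bridge (R : Type) [CommRing R] (M Y : ModuleCat.{0} R) (n : ℕ) (hn : 1 ≤ n)
    (q : Ideal R) [hq : q.IsPrime] :
    Nontrivial (LocalizedModule q.primeCompl (ExtGrp R M Y n)) ↔ ¬ LV Y n q M := by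
  obtain ⟨p, rfl⟩ : ∃ p, n = p + 1 := ⟨n - 1, by omega⟩
  rw [← not_subsingleton_iff_nontrivial, not_iff_not, LocalizedModule.subsingleton_iff]
  let P := projectiveResolution M
  let e1 : ExtGrp R M Y (p+1) ≅ (P.complex.linearYonedaObj R Y).homology (p+1) := P.isoExt (p+1) Y
  let K := P.complex.linearYonedaObj R Y
  let e2 : K.homology (p+1) ≅ (K.sc' p (p+1) (p+2)).homology :=
    (ShortComplex.homologyFunctor _).mapIso (K.isoSc' p (p+1) (p+2) (by simp) (by simp))
  let e3 := (K.sc' p (p+1) (p+2)).moduleCatHomologyIso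
  let e := (e1 ≪≫ e2 ≪≫ e3).toLinearEquiv
  have smulMk : ∀ (f : P.complex.X (p+1) ⟶ Y) (hf : P.complex.d (p+2) (p+1) ≫ f = 0) (s : R),
      s • P.extMk f (p+2) rfl hf = P.extMk (s • f) (p+2) rfl (by simp [hf]) := by
    intro f hf s
    rw [Abelian.Ext.smul_eq_comp_mk₀, ProjectiveResolution.extMk_comp_mk₀]
    congr 1
  have key1 : LV Y (p+1) q M ↔ ∀ (f : P.complex.X (p+1) ⟶ Y),
      P.complex.d (p+2) (p+1) ≫ f = 0 → ∃ s ∉ q, ∃ g, P.complex.d (p+1) p ≫ g = s • f := by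
    constructor
    · intro h f hf
      obtain ⟨s, hs, h0⟩ := h (P.extMk f (p+2) rfl hf)
      rw [smulMk, P.extMk_eq_zero_iff _ _ _ _ p rfl] at h0
      exact ⟨s, hs, h0⟩
    · intro h x
      obtain ⟨f, hf, rfl⟩ := P.extMk_surjective x (p+2) rfl
      obtain ⟨s, hs, h0⟩ := h f hf
      refine ⟨s, hs, ?_⟩
      rw [smulMk, P.extMk_eq_zero_iff _ _ _ _ p rfl]
      exact h0
  rw [key1]
  constructor
  · intro h f hf
    let c : LinearMap.ker (K.sc' p (p+1) (p+2)).g.hom := ⟨f, hf⟩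
    let y : (K.sc' p (p+1) (p+2)).moduleCatLeftHomologyData.H := Submodule.Quotient.mk c
    obtain ⟨s, hs, h0⟩ := h (e.symm y)
    refine ⟨s, hs, ?_⟩
    rw [← map_smul, LinearEquiv.map_eq_zero_iff] at h0
    have h1 : (Submodule.Quotient.mk (s • c) : _ ⧸ LinearMap.range (K.sc' p (p+1) (p+2)).moduleCatToCycles) = 0 := h0
    rw [Submodule.Quotient.mk_eq_zero] at h1
    obtain ⟨g, hg⟩ := h1
    exact ⟨g, congrArg Subtype.val hg⟩
  · intro h m
    obtain ⟨c, hc⟩ := Submodule.Quotient.mk_surjective _ (e m : _ ⧸ LinearMap.range (K.sc' p (p+1) (p+2)).moduleCatToCycles)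
    obtain ⟨s, hs, g, hg⟩ := h c.1 c.2
    refine ⟨s, hs, ?_⟩
    apply e.injective
    rw [map_smul, map_zero]
    have h1 : (Submodule.Quotient.mk (s • c) : _ ⧸ LinearMap.range (K.sc' p (p+1) (p+2)).moduleCatToCycles) = 0 := by
      rw [Submodule.Quotient.mk_eq_zero]
      exact ⟨g, Subtype.ext hg⟩
    rw [← hc]
    exact h1

open Abelian in
theorem LV.mid {R : Type} [CommRing R] {Y : ModuleCat.{0} R} {n : ℕ} {q : Ideal R} [hq : q.IsPrime]
    {S : ShortComplex (ModuleCat.{0} R)} (hS : S.ShortExact) (h1 : LV Y n q S.X₁)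
    (h3 : LV Y n q S.X₃) : LV Y n q S.X₂ := by
  intro x
  obtain ⟨s, hs, h⟩ := h1 ((Ext.mk₀ S.f).comp x (zero_add n))
  rw [← Ext.comp_smul] at h
  obtain ⟨y, hy⟩ := Ext.contravariant_sequence_exact₂ hS Y (s • x) h
  obtain ⟨t, ht, h'⟩ := h3 y
  refine ⟨t * s, fun hh => (hq.mem_or_mem hh).elim ht hs, ?_⟩
  rw [mul_smul, ← hy, ← Ext.comp_smul, h', Ext.comp_zero]

open Abelian in
theorem LV.left {R : Type} [CommRing R] {Y : ModuleCat.{0} R} {n : ℕ} {q : Ideal R} [hq : q.IsPrime]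
    {S : ShortComplex (ModuleCat.{0} R)} (hS : S.ShortExact) (h2 : LV Y n q S.X₂)
    (h3 : LV Y (n + 1) q S.X₃) : LV Y n q S.X₁ := by
  intro x
  obtain ⟨s, hs, h⟩ := h3 (hS.extClass.comp x (add_comm 1 n))
  rw [← Ext.comp_smul] at h
  obtain ⟨y, hy⟩ := Ext.contravariant_sequence_exact₁ hS Y (s • x) (add_comm 1 n) h
  obtain ⟨t, ht, h'⟩ := h2 y
  refine ⟨t * s, fun hh => (hq.mem_or_mem hh).elim ht hs, ?_⟩
  rw [mul_smul, ← hy, ← Ext.comp_smul, h', Ext.comp_zero]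

/-- A Nakayama-type lemma. -/
theorem nak {R : Type} [CommRing R] {E : Type} [AddCommGroup E] [Module R E] [Module.Finite R E]
    (q : Ideal R) [hq : q.IsPrime] (x : R) (hx : x ∈ q)
    (h : ∀ e : E, ∃ s ∉ q, ∃ e', s • e = x • e') : ∀ e : E, ∃ s ∉ q, s • e = 0 := by
  obtain ⟨T, hT⟩ := (Module.Finite.fg_top : (⊤ : Submodule R E).FG)
  choose s hs e' he' using h
  let S := ∏ t ∈ T, s t
  have hS : S ∉ q := by
    intro hh
    obtain ⟨t, -, ht⟩ := (Ideal.IsPrime.prod_mem_iff).1 hh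
    exact hs t ht
  let f : Module.End R E := S • LinearMap.id
  have hf : LinearMap.range f ≤ q • ⊤ := by
    rw [LinearMap.range_eq_map, ← hT, Submodule.map_span, Submodule.span_le]
    rintro _ ⟨t, ht, rfl⟩
    obtain ⟨c, hc⟩ : s t ∣ S := Finset.dvd_prod_of_mem s ht
    have : f t = x • (c • e' t) := by
      change S • t = _
      rw [hc, mul_comm, mul_smul, he', smul_comm]
    rw [this, hT]
    exact Submodule.smul_mem_smul hx trivial
  obtain ⟨p, hp, -, hc, h0⟩ :=
    LinearMap.exists_monic_and_natDegree_eq_and_coeff_mem_pow_and_aeval_eq_zero R f q hf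
  have hev : ∀ e : E, p.eval S • e = 0 := by
    intro e
    have h1 : Polynomial.aeval f p = p.eval S • LinearMap.id := by
      have : f = algebraMap R (Module.End R E) S := rfl
      rw [this, Polynomial.aeval_algebraMap_apply]
      rfl
    have := congrArg (fun g : Module.End R E => g e) h0
    rw [h1] at this
    exact this
  refine fun e => ⟨p.eval S, ?_, hev e⟩
  rw [Polynomial.eval_eq_sum_range, Finset.sum_range_succ, hp.coeff_natDegree, one_mul]
  intro hh
  have : ∑ i ∈ Finset.range p.natDegree, p.coeff i * S ^ i ∈ q := by
    refine Ideal.sum_mem _ fun i hi => Ideal.mul_mem_right _ _ ?_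
    refine Ideal.pow_le_self ?_ (hc i)
    have := Finset.mem_range.1 hi
    omega
  exact hS (hq.mem_of_pow_mem _ ((Ideal.add_mem_iff_right _ this).1 hh))

/-- Multiplication by `a` as a map `R/K → R/J`. -/
def mulMap {R : Type} [CommRing R] (K J : Ideal R) (a : R) (h : ∀ r, r ∈ K ↔ a * r ∈ J) :
    (R ⧸ K) →ₗ[R] (R ⧸ J) :=
  Submodule.mapQ K J (LinearMap.lsmul R R a) fun r hr => (h r).1 hr

def quotMap {R : Type} [CommRing R] (J : Ideal R) (a : R) :
    (R ⧸ J) →ₗ[R] (R ⧸ (J ⊔ Ideal.span {a})) :=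
  Submodule.mapQ J _ LinearMap.id fun _ hr => Ideal.mem_sup_left hr

theorem seq_exact {R : Type} [CommRing R] (K J : Ideal R) (a : R) (h : ∀ r, r ∈ K ↔ a * r ∈ J) :
    Function.Exact (mulMap K J a h) (quotMap J a) := by
  intro y
  obtain ⟨y, rfl⟩ := Submodule.Quotient.mk_surjective _ y
  have : quotMap J a (Submodule.Quotient.mk y) = 0 ↔ y ∈ J ⊔ Ideal.span {a} :=
    Submodule.Quotient.mk_eq_zero _
  rw [this, Submodule.mem_sup]
  constructor
  · rintro ⟨j, hj, z, hz, rfl⟩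
    obtain ⟨c, rfl⟩ := Ideal.mem_span_singleton'.1 hz
    refine ⟨Submodule.Quotient.mk c, ?_⟩
    change Submodule.Quotient.mk (a * c) = _
    rw [Submodule.Quotient.eq]
    have : a * c - (j + c * a) = - j := by ring
    rw [this]; exact J.neg_mem hj
  · rintro ⟨c, hc⟩
    obtain ⟨c, rfl⟩ := Submodule.Quotient.mk_surjective _ c
    have hc : (Submodule.Quotient.mk (a * c) : R ⧸ J) = Submodule.Quotient.mk y := hc
    rw [Submodule.Quotient.eq] at hc
    exact ⟨_, J.neg_mem hc, c * a, Ideal.mem_span_singleton'.2 ⟨c, rfl⟩, by ring⟩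

/-- The sequence `R/K → R/J → R/(J+a)`. -/
def colonSeq {R : Type} [CommRing R] (K J : Ideal R) (a : R) (h : ∀ r, r ∈ K ↔ a * r ∈ J) :
    ShortComplex (ModuleCat.{0} R) :=
  ModuleCat.shortComplexOfCompEqZero (mulMap K J a h) (quotMap J a)
    (seq_exact K J a h).linearMap_comp_eq_zero

theorem colonSeq_exact {R : Type} [CommRing R] (K J : Ideal R) (a : R)
    (h : ∀ r, r ∈ K ↔ a * r ∈ J) : (colonSeq K J a h).ShortExact where
  exact := ModuleCat.shortComplex_exact _ (seq_exact K J a h)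
  mono_f := by
    rw [ModuleCat.mono_iff_injective]
    change Function.Injective (mulMap K J a h)
    rw [injective_iff_map_eq_zero]
    intro c hc
    obtain ⟨c, rfl⟩ := Submodule.Quotient.mk_surjective _ c
    have hc : (Submodule.Quotient.mk (a * c) : R ⧸ J) = 0 := hc
    rw [Submodule.Quotient.mk_eq_zero] at hc ⊢
    exact (h c).2 hc
  epi_g := by
    rw [ModuleCat.epi_iff_surjective]
    change Function.Surjective (quotMap J a)
    intro y
    obtain ⟨y, rfl⟩ := Submodule.Quotient.mk_surjective _ y
    exact ⟨Submodule.Quotient.mk y, rfl⟩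

theorem colonSeq_f {R : Type} [CommRing R] (J : Ideal R) (a : R)
    (h : ∀ r, r ∈ J ↔ a * r ∈ J) :
    (colonSeq J J a h).f = a • 𝟙 (ModuleCat.of R (R ⧸ J)) := by
  ext y
  obtain ⟨y, rfl⟩ := Submodule.Quotient.mk_surjective _ y
  rfl

/-- Local vanishing for cyclic modules. -/
def W {R : Type} [CommRing R] (n : ℕ) (q J : Ideal R) : Prop :=
  LV (ModuleCat.of R R) n q (ModuleCat.of R (R ⧸ J))

theorem W.mid {R : Type} [CommRing R] {n : ℕ} {q K J : Ideal R} [hq : q.IsPrime] {a : R}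
    (h : ∀ r, r ∈ K ↔ a * r ∈ J) (h1 : W n q K) (h3 : W n q (J ⊔ Ideal.span {a})) : W n q J :=
  LV.mid (colonSeq_exact K J a h) h1 h3

theorem W.left {R : Type} [CommRing R] {n : ℕ} {q K J : Ideal R} [hq : q.IsPrime] {a : R}
    (h : ∀ r, r ∈ K ↔ a * r ∈ J) (h2 : W n q J) (h3 : W (n + 1) q (J ⊔ Ideal.span {a})) :
    W n q K :=
  LV.left (colonSeq_exact K J a h) h2 h3

open Abelian in
theorem LV.nak {R : Type} [CommRing R] [IsNoetherianRing R] {Y M N : ModuleCat.{0} R}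
    [Module.Finite R Y] [Module.Finite R M] {n : ℕ} {q : Ideal R}
    [hq : q.IsPrime] {a : R} (ha : a ∈ q) (f : M ⟶ M) (g : M ⟶ N) (w : f ≫ g = 0)
    (hf : f = a • 𝟙 M) (hS : (ShortComplex.mk f g w).ShortExact)
    (h3 : LV Y (n + 1) q N) : LV Y n q M := by
  unfold LV
  apply PureCodim.nak q a ha
  intro x
  obtain ⟨s, hs, h⟩ := h3 (hS.extClass.comp x (add_comm 1 n))
  rw [← Ext.comp_smul] at h
  obtain ⟨y, hy⟩ := Ext.contravariant_sequence_exact₁ hS _ (s • x) (add_comm 1 n) h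
  refine ⟨s, hs, y, ?_⟩
  have key : ∀ z : Ext.{0} M Y n, (Ext.mk₀ f).comp z (zero_add n) = a • z := by
    intro z
    rw [hf, Ext.mk₀_smul, Ext.smul_comp, Ext.mk₀_id_comp]
  exact hy.symm.trans (key y)

theorem W.nak {R : Type} [CommRing R] [IsNoetherianRing R] {n : ℕ} {q J : Ideal R}
    [hq : q.IsPrime] {a : R} (ha : a ∈ q)
    (h : ∀ r, r ∈ J ↔ a * r ∈ J) (h3 : W (n + 1) q (J ⊔ Ideal.span {a})) : W n q J :=
  LV.nak (M := ModuleCat.of R (R ⧸ J)) ha (colonSeq J J a h).f (colonSeq J J a h).g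
    (colonSeq J J a h).zero (colonSeq_f J a h) (colonSeq_exact J J a h) h3

theorem smul_id_zero {R : Type} [CommRing R] {J : Ideal R} {a : R} (ha : a ∈ J) :
    a • 𝟙 (ModuleCat.of R (R ⧸ J)) = 0 := by
  apply ModuleCat.hom_ext
  apply LinearMap.ext
  intro y
  obtain ⟨y, rfl⟩ := Submodule.Quotient.mk_surjective _ y
  change (Submodule.Quotient.mk (a * y) : R ⧸ J) = 0
  rw [Submodule.Quotient.mk_eq_zero]
  exact J.mul_mem_right _ ha

open Abelian in
theorem smul_ext_zero {R : Type} [CommRing R] {n : ℕ} {J : Ideal R} {a : R} (ha : a ∈ J)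
    {Y : ModuleCat.{0} R} (e : Ext.{0} (ModuleCat.of R (R ⧸ J)) Y n) : a • e = 0 := by
  have : a • e = (Ext.mk₀ (a • 𝟙 (ModuleCat.of R (R ⧸ J)))).comp e (zero_add n) := by
    rw [Ext.mk₀_smul, Ext.smul_comp, Ext.mk₀_id_comp]
  rw [this, smul_id_zero ha, Ext.mk₀_zero, Ext.zero_comp]

theorem W.of_mem {R : Type} [CommRing R] {n : ℕ} {q J : Ideal R} {a : R} (ha : a ∈ J)
    (haq : a ∉ q) : W n q J := fun e => ⟨a, haq, smul_ext_zero ha e⟩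

theorem W.mono {R : Type} [CommRing R] {n : ℕ} {q q' J : Ideal R} (h : q ≤ q') (hW : W n q' J) :
    W n q J := fun e => by
  obtain ⟨s, hs, h0⟩ := hW e
  exact ⟨s, fun hh => hs (h hh), h0⟩

/-- Devissage for cyclic modules. -/
theorem devissage {R : Type} [CommRing R] [IsNoetherianRing R] (P : Ideal R → Prop) (J₀ : Ideal R)
    (htop : P ⊤)
    (hprime : ∀ J : Ideal R, J₀ ≤ J → J.IsPrime → (∀ J', J < J' → P J') → P J)
    (hstep : ∀ (J K : Ideal R) (a : R), (∀ r, r ∈ K ↔ a * r ∈ J) → P K →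
      P (J ⊔ Ideal.span {a}) → P J) : ∀ J, J₀ ≤ J → P J := by
  intro J
  induction J using WellFoundedGT.induction with
  | ind J ih =>
  intro hJ
  by_cases ht : J = ⊤
  · exact ht ▸ htop
  by_cases hp : J.IsPrime
  · exact hprime J hJ hp fun J' h => ih J' h (hJ.trans h.le)
  rw [Ideal.isPrime_iff] at hp
  push Not at hp
  obtain ⟨a, b, hab, ha, hb⟩ := hp ht
  let K : Ideal R := Submodule.comap (LinearMap.lsmul R R a) J
  have hK : ∀ r, r ∈ K ↔ a * r ∈ J := fun _ => Iff.rfl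
  have hJK : J < K := by
    refine lt_of_le_of_ne (fun r hr => (hK r).2 (J.mul_mem_left _ hr)) ?_
    rintro h
    exact hb (h ▸ (hK b).2 hab)
  have hJa : J < J ⊔ Ideal.span {a} := by
    refine lt_of_le_of_ne le_sup_left ?_
    intro h
    apply ha
    rw [h]
    exact Ideal.mem_sup_right (Ideal.mem_span_singleton_self a)
  exact hstep J K a hK (ih K hJK (hJ.trans hJK.le)) (ih _ hJa (hJ.trans hJa.le))

theorem prime_colon {R : Type} [CommRing R] {J : Ideal R} (hJ : J.IsPrime) {a : R} (ha : a ∉ J) :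
    ∀ r, r ∈ J ↔ a * r ∈ J :=
  fun r => ⟨fun h => J.mul_mem_left _ h, fun h => (hJ.mem_or_mem h).resolve_left ha⟩

theorem W.top {R : Type} [CommRing R] {n : ℕ} {q : Ideal R} [hq : q.IsPrime] : W n q ⊤ :=
  W.of_mem (a := 1) trivial ((Ideal.ne_top_iff_one q).1 hq.ne_top)

theorem W.all {R : Type} [CommRing R] [IsNoetherianRing R] {q : Ideal R} [hq : q.IsPrime] (h : ℕ)
    (H : ∀ n, h < n → W n q q) : ∀ J : Ideal R, ∀ n, h < n → W n q J := by
  intro J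
  refine devissage (fun J => ∀ n, h < n → W n q J) ⊥ (fun _ _ => W.top) ?_ ?_ J bot_le
  · intro J _ hJ ih n hn
    by_cases hJq : J ≤ q
    · rcases hJq.eq_or_lt with rfl | hlt
      · exact H n hn
      · obtain ⟨x, hx, hxJ⟩ := SetLike.exists_of_lt hlt
        refine W.nak hx (prime_colon hJ hxJ) (ih _ ?_ _ (by omega))
        exact left_lt_sup.2 (by simpa [Ideal.span_le] using hxJ)
    · obtain ⟨a, ha, haq⟩ := SetLike.not_le_iff_exists.1 hJq
      exact W.of_mem ha haq
  · intro J K a hK h1 h2 n hn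
    exact W.mid hK (h1 n hn) (h2 n hn)

/-- The lemma of Bass. -/
theorem bass {R : Type} [CommRing R] [IsNoetherianRing R] {q q' : Ideal R} [hq : q.IsPrime]
    [hq' : q'.IsPrime] (hlt : q < q') (hcov : ∀ r : Ideal R, r.IsPrime → q < r → r ≤ q' → r = q')
    {n : ℕ} (h : ¬ W n q q) : ¬ W (n + 1) q' q' := by
  intro H
  apply h
  obtain ⟨x, hx, hxq⟩ := SetLike.exists_of_lt hlt
  apply W.mono hlt.le
  apply W.nak hx (prime_colon hq hxq)
  have hlt' : q < q ⊔ Ideal.span {x} := left_lt_sup.2 (by simpa [Ideal.span_le] using hxq)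
  refine devissage (fun J => W (n + 1) q' J) _ W.top ?_ ?_ _ le_rfl
  · intro J hJ0 hJ _
    by_cases hJq : J ≤ q'
    · rw [hcov J hJ (hlt'.trans_le hJ0) hJq]
      exact H
    · obtain ⟨a, ha, haq⟩ := SetLike.not_le_iff_exists.1 hJq
      exact W.of_mem ha haq
  · intro J K a hK h1 h2
    exact W.mid hK h1 h2

/-- `J` can be extended to the maximal ideal by a regular sequence of length `i`. -/
inductive RegChain {R : Type} [CommRing R] [IsLocalRing R] : Ideal R → ℕ → Prop
  | base : RegChain (IsLocalRing.maximalIdeal R) 0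
  | step (J : Ideal R) (i : ℕ) (x : R) (hx : x ∈ IsLocalRing.maximalIdeal R)
      (h : ∀ r, r ∈ J ↔ x * r ∈ J) (hc : RegChain (J ⊔ Ideal.span {x}) i) : RegChain J (i + 1)

theorem dim_nonpos {R : Type} [CommRing R] [IsLocalRing R] (J : Ideal R)
    (h : ∀ p : Ideal R, p.IsPrime → J ≤ p → p = IsLocalRing.maximalIdeal R) :
    ringKrullDim (R ⧸ J) ≤ 0 := by
  rw [ringKrullDim_quotient]
  have : Subsingleton (PrimeSpectrum.zeroLocus (J : Set R)) := by
    constructor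
    rintro ⟨p, hp⟩ ⟨p', hp'⟩
    apply Subtype.ext
    apply PrimeSpectrum.ext
    change p.asIdeal = p'.asIdeal
    rw [h _ p.2 hp, h _ p'.2 hp']
  exact Order.krullDim_nonpos_of_subsingleton

theorem dim_step {R : Type} [CommRing R] [IsLocalRing R] [IsNoetherianRing R] (J : Ideal R)
    (x : R) (hx : x ∈ IsLocalRing.maximalIdeal R) (hJ : J ≤ IsLocalRing.maximalIdeal R) :
    ringKrullDim (R ⧸ J) ≤ ringKrullDim (R ⧸ (J ⊔ Ideal.span {x})) + 1 := by
  have hJt : J ≠ ⊤ := fun h => (IsLocalRing.maximalIdeal.isMaximal R).ne_top (top_le_iff.1 (h ▸ hJ))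
  have : Nontrivial (R ⧸ J) := Ideal.Quotient.nontrivial_iff.2 hJt
  have : IsLocalRing (R ⧸ J) := IsLocalRing.of_surjective' _ Ideal.Quotient.mk_surjective
  have hm : Ideal.Quotient.mk J x ∈ IsLocalRing.maximalIdeal (R ⧸ J) := by
    rw [IsLocalRing.mem_maximalIdeal, mem_nonunits_iff]
    intro hu
    obtain ⟨y, hy⟩ := hu.exists_right_inv
    obtain ⟨y, rfl⟩ := Ideal.Quotient.mk_surjective y
    rw [← map_mul, ← map_one (Ideal.Quotient.mk J), Ideal.Quotient.eq] at hy
    have h1 : (1 : R) ∈ IsLocalRing.maximalIdeal R := by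
      have h2 := sub_mem (Ideal.mul_mem_right y _ hx) (hJ hy)
      rwa [sub_sub_cancel] at h2
    exact (Ideal.ne_top_iff_one _).1 (IsLocalRing.maximalIdeal.isMaximal R).ne_top h1
  have h := ringKrullDim_le_ringKrullDim_quotient_add_card {Ideal.Quotient.mk J x}
    (by rw [IsLocalRing.ringJacobson_eq_maximalIdeal]; simpa using hm)
  refine h.trans ?_
  simp only [Finset.card_singleton, Nat.cast_one]
  gcongr
  apply le_of_eq
  apply ringKrullDim_eq_of_ringEquiv
  have : Ideal.span {Ideal.Quotient.mk J x} = (Ideal.span {x}).map (Ideal.Quotient.mk J) := by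
    rw [Ideal.map_span, Set.image_singleton]
  rw [Finset.coe_singleton, this]
  exact DoubleQuot.quotQuotEquivQuotSup J (Ideal.span {x})

theorem regChain_exists {R : Type} [CommRing R] [IsLocalRing R] [IsNoetherianRing R] (i : ℕ) :
    ∀ (J : Ideal R) (s : Finset R), s.card = i →
      J ⊔ Ideal.span (s : Set R) = IsLocalRing.maximalIdeal R →
      (i : WithBot ℕ∞) ≤ ringKrullDim (R ⧸ J) → J.IsPrime ∧ RegChain J i := by
  classical
  induction i with
  | zero =>
    intro J s hs hJ _
    rw [Finset.card_eq_zero] at hs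
    subst hs
    simp at hJ
    subst hJ
    exact ⟨inferInstance, RegChain.base⟩
  | succ i ih =>
    intro J s hs hJ hd
    set m := IsLocalRing.maximalIdeal R with hm
    have hJm : J ≤ m := hJ ▸ le_sup_left
    have hdim : ¬ ringKrullDim (R ⧸ J) ≤ 0 := by
      intro h
      have := hd.trans h
      norm_cast at this
    have hjac : m ≤ Ideal.jacobson ⊥ := (IsLocalRing.jacobson_eq_maximalIdeal ⊥ bot_ne_top).ge
    -- choose the element
    obtain ⟨x, hxm, hx2, hxp⟩ : ∃ x ∈ m, x ∉ J ⊔ m * m ∧ ∀ p ∈ J.minimalPrimes, x ∉ p := by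
      by_contra hcon
      push Not at hcon
      have hfin : J.minimalPrimes.Finite := J.finite_minimalPrimes_of_isNoetherianRing
      have hsub : (m : Set R) ⊆ ⋃ I ∈ (↑(insert (J ⊔ m * m) hfin.toFinset) : Set (Ideal R)), (id I : Ideal R) := by
        intro x hx
        by_cases h : x ∈ J ⊔ m * m
        · exact Set.mem_biUnion (by simp) h
        · obtain ⟨p, hp, hxp⟩ := hcon x hx h
          exact Set.mem_biUnion (x := p) (by simp [hp]) hxp
      rw [Ideal.subset_union_prime (J ⊔ m * m) (J ⊔ m * m)] at hsub
      · obtain ⟨I, hI, hmI⟩ := hsub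
        rw [Finset.mem_insert] at hI
        apply hdim
        rcases hI with rfl | hI
        · have hmJ : m ≤ J :=
            Submodule.le_of_le_smul_of_le_jacobson_bot (IsNoetherian.noetherian m) hjac hmI
          apply dim_nonpos
          intro p hp hJp
          exact ((IsLocalRing.maximalIdeal.isMaximal R).eq_of_le hp.ne_top (hmJ.trans hJp)).symm
        · have hI' := hfin.mem_toFinset.1 hI
          have hIp := hI'.1.1
          apply dim_nonpos
          intro p hp hJp
          have h1 : p ≤ m := IsLocalRing.le_maximalIdeal hp.ne_top
          exact le_antisymm h1 (hmI.trans (hI'.2 ⟨hp, hJp⟩ (h1.trans hmI)))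
      · intro I hI hne _
        rw [Finset.mem_insert] at hI
        exact (hfin.mem_toFinset.1 (hI.resolve_left hne)).1.1
    -- exchange
    obtain ⟨t, hts, htx⟩ : ∃ t ∈ s, t ∈ (J ⊔ Ideal.span {x}) ⊔ Ideal.span ((s.erase t : Finset R) : Set R) := by
      have hx' := hxm
      rw [← hJ] at hx'
      obtain ⟨j, hj, y, hy, hxy⟩ := Submodule.mem_sup.1 hx'
      obtain ⟨c, -, hc⟩ := Submodule.mem_span_finset.1 hy
      obtain ⟨t, hts, htu⟩ : ∃ t ∈ s, IsUnit (c t) := by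
        by_contra hcon
        push Not at hcon
        apply hx2
        rw [← hxy]
        refine Ideal.add_mem _ (Ideal.mem_sup_left hj) (Ideal.mem_sup_right ?_)
        rw [← hc]
        refine Ideal.sum_mem _ fun t ht => ?_
        refine Ideal.mul_mem_mul ((IsLocalRing.mem_maximalIdeal _).2 (hcon t ht)) ?_
        rw [← hJ]
        exact Ideal.mem_sup_right (Ideal.subset_span ht)
      refine ⟨t, hts, ?_⟩
      rw [← Finset.add_sum_erase s _ hts] at hc
      rw [← Ideal.unit_mul_mem_iff_mem _ htu]
      have : c t * t = (-j + x) + -(∑ u ∈ s.erase t, c u • u) := by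
        rw [← hxy, ← hc]; simp only [smul_eq_mul]; ring
      rw [this]
      refine Ideal.add_mem _ (Ideal.mem_sup_left (Ideal.add_mem _ (Ideal.mem_sup_left (J.neg_mem hj))
        (Ideal.mem_sup_right (Ideal.mem_span_singleton_self x)))) (Ideal.mem_sup_right ?_)
      refine neg_mem (Ideal.sum_mem _ fun u hu => Ideal.mul_mem_left _ _ (Ideal.subset_span hu))
    have hgen : (J ⊔ Ideal.span {x}) ⊔ Ideal.span ((s.erase t : Finset R) : Set R) = m := by
      apply le_antisymm
      · refine sup_le (sup_le hJm (by simpa [Ideal.span_le] using hxm)) ?_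
        refine le_trans (Ideal.span_mono (by simp)) (hJ ▸ le_sup_right)
      · rw [← hJ]
        refine sup_le (le_sup_left.trans le_sup_left) ?_
        rw [Ideal.span_le]
        intro u hu
        by_cases hut : u = t
        · exact hut ▸ htx
        · exact Ideal.mem_sup_right (Ideal.subset_span (by simp [hut]; exact hu))
    have hd' : (i : WithBot ℕ∞) ≤ ringKrullDim (R ⧸ (J ⊔ Ideal.span {x})) := by
      have h1 := hd.trans (dim_step J x hxm hJm)
      push_cast at h1
      generalize ringKrullDim (R ⧸ (J ⊔ Ideal.span {x})) = D at h1 ⊢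
      cases D with
      | bot => exact absurd (le_bot_iff.1 h1) (by exact_mod_cast WithBot.coe_ne_bot)
      | coe D =>
        cases D with
        | top => exact WithBot.coe_le_coe.2 le_top
        | coe D =>
          have h2 : i + 1 ≤ D + 1 := by exact_mod_cast h1
          have h3 : i ≤ D := by omega
          exact_mod_cast h3
    obtain ⟨hP, hC⟩ := ih _ (s.erase t) (by rw [Finset.card_erase_of_mem hts]; omega) hgen hd'
    have hJp : J.IsPrime := by
      obtain ⟨p, hp, hple⟩ := Ideal.exists_minimalPrimes_le (I := J) (J := J ⊔ Ideal.span {x}) le_sup_left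
      have hpp := hp.1.1
      have hle : p ≤ J ⊔ m • p := by
        intro y hy
        obtain ⟨j, hj, z, hz, rfl⟩ := Submodule.mem_sup.1 (hple hy)
        obtain ⟨r, rfl⟩ := Ideal.mem_span_singleton'.1 hz
        have h1 : r * x ∈ p := (Ideal.add_mem_iff_right _ (hp.1.2 hj)).1 hy
        have h2 := (hpp.mem_or_mem h1).resolve_right (hxp p hp)
        refine Ideal.add_mem _ (Ideal.mem_sup_left hj) (Ideal.mem_sup_right ?_)
        rw [mul_comm]
        exact Submodule.smul_mem_smul hxm h2
      have hpJ : p ≤ J := Submodule.le_of_le_smul_of_le_jacobson_bot (IsNoetherian.noetherian p) hjac hle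
      exact le_antisymm hpJ hp.1.2 ▸ hpp
    refine ⟨hJp, RegChain.step J i x hxm (prime_colon hJp ?_) hC⟩
    intro hxJ
    exact hx2 (Ideal.mem_sup_left hxJ)

open Abelian in
theorem low_step {R : Type} [CommRing R] {k M N : ModuleCat.{0} R} {a : R} (f : M ⟶ M) (g : M ⟶ N)
    (w : f ≫ g = 0) (hf : f = a • 𝟙 M) (hS : (ShortComplex.mk f g w).ShortExact)
    (hk : ∀ n (e : Ext.{0} k M n), a • e = 0) (i : ℕ)
    (h : ∀ n < i, ∀ e : Ext.{0} k N n, e = 0) : ∀ n < i + 1, ∀ e : Ext.{0} k M n, e = 0 := by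
  have key : ∀ n (z : Ext.{0} k M n), z.comp (Ext.mk₀ f) (add_zero n) = 0 := by
    intro n z
    rw [hf, Ext.mk₀_smul, Ext.comp_smul, Ext.comp_mk₀_id, hk]
  intro n hn e
  cases n with
  | zero =>
    obtain ⟨φ, rfl⟩ := Ext.homEquiv₀.symm.surjective e
    have h1 := key 0 (Ext.mk₀ φ)
    rw [Ext.mk₀_comp_mk₀] at h1
    have h2 : φ ≫ f = 0 := Ext.homEquiv₀.symm.injective (by simpa using h1)
    have : Mono f := hS.mono_f
    have h3 : φ = 0 := by rwa [← cancel_mono f, Limits.zero_comp]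
    subst h3
    simp
  | succ n =>
    obtain ⟨y, hy⟩ := Ext.covariant_sequence_exact₁ k hS e (key _ e) rfl
    rw [← hy, h n (by omega) y, Ext.zero_comp]

open Abelian in
theorem low {R : Type} [CommRing R] [IsLocalRing R] {J : Ideal R} {i : ℕ} (h : RegChain J i) :
    ∀ n < i, ∀ e : Ext.{0} (ModuleCat.of R (R ⧸ IsLocalRing.maximalIdeal R))
      (ModuleCat.of R (R ⧸ J)) n, e = 0 := by
  induction h with
  | base => intro n hn; omega
  | step J i x hx h hc ih =>
    exact low_step (M := ModuleCat.of R (R ⧸ J)) (colonSeq J J x h).f (colonSeq J J x h).g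
      (colonSeq J J x h).zero (colonSeq_f J x h) (colonSeq_exact J J x h)
      (fun n e => smul_ext_zero hx e) i ih

open Abelian in
theorem high_step {R : Type} [CommRing R] {Y : ModuleCat.{0} R} {S : ShortComplex (ModuleCat.{0} R)}
    (hS : S.ShortExact) (c : ℕ) (h1 : ∀ n, c < n → ∀ e : Ext.{0} S.X₁ Y n, e = 0)
    (h2 : ∀ n, c < n → ∀ e : Ext.{0} S.X₂ Y n, e = 0) :
    ∀ n, c + 1 < n → ∀ e : Ext.{0} S.X₃ Y n, e = 0 := by
  intro n hn e
  obtain ⟨n, rfl⟩ : ∃ p, n = 1 + p := ⟨n - 1, by omega⟩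
  obtain ⟨y, hy⟩ := Ext.contravariant_sequence_exact₃ hS Y e (h2 _ (by omega) _) rfl
  rw [← hy, h1 n (by omega) y, Ext.comp_zero]

open Abelian in
theorem high {R : Type} [CommRing R] [IsLocalRing R] {Y : ModuleCat.{0} R} {J : Ideal R} {i : ℕ}
    (h : RegChain J i) : ∀ c, (∀ n, c < n → ∀ e : Ext.{0} (ModuleCat.of R (R ⧸ J)) Y n, e = 0) →
    ∀ n, c + i < n →
      ∀ e : Ext.{0} (ModuleCat.of R (R ⧸ IsLocalRing.maximalIdeal R)) Y n, e = 0 := by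
  induction h with
  | base => intro c h n hn; exact h n hn
  | step J i x hx h hc ih =>
    intro c H n hn
    exact ih (c + 1) (high_step (colonSeq_exact J J x h) c H H) n (by omega)

theorem residue_nonvanishing {R : Type} [CommRing R] [IsLocalRing R] {d : ℕ}
    (h : RegChain (⊥ : Ideal R) d) {n : ℕ}
    (hn : ¬ W n (IsLocalRing.maximalIdeal R) (IsLocalRing.maximalIdeal R)) : n = d := by
  have one : (1 : R) ∉ IsLocalRing.maximalIdeal R :=
    (Ideal.ne_top_iff_one _).1 (IsLocalRing.maximalIdeal.isMaximal R).ne_top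
  let ε : (R ⧸ (⊥ : Ideal R)) ≃ₗ[R] R := Submodule.quotEquivOfEqBot ⊥ rfl
  by_contra hne
  apply hn
  rcases lt_or_gt_of_ne hne with hlt | hgt
  · intro e
    refine ⟨1, one, ?_⟩
    have h1 := low h n hlt (e.comp (Abelian.Ext.mk₀ ε.symm.toModuleIso.hom) (add_zero n))
    have h2 := congrArg
      (fun z => z.comp (Abelian.Ext.mk₀ ε.symm.toModuleIso.inv) (add_zero n)) h1
    rw [one_smul]
    rw [Abelian.Ext.comp_assoc_of_third_deg_zero, Abelian.Ext.mk₀_comp_mk₀, Iso.hom_inv_id,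
      Abelian.Ext.comp_mk₀_id, Abelian.Ext.zero_comp] at h2
    exact h2
  · intro e
    refine ⟨1, one, ?_⟩
    rw [one_smul]
    refine high h 0 ?_ n (by omega) e
    intro n hn e
    have : Module.Projective R (R ⧸ (⊥ : Ideal R)) := Module.Projective.of_equiv ε.symm
    have : Projective (ModuleCat.of R (R ⧸ (⊥ : Ideal R))) := by infer_instance
    obtain ⟨n, rfl⟩ : ∃ p, n = p + 1 := ⟨n - 1, by omega⟩
    exact Abelian.Ext.eq_zero_of_projective e

theorem bot_nonvanishing {R : Type} [CommRing R] : ¬ W 0 (⊥ : Ideal R) ⊥ := by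
  intro h
  let ε : (R ⧸ (⊥ : Ideal R)) ≃ₗ[R] R := Submodule.quotEquivOfEqBot ⊥ rfl
  obtain ⟨s, hs, h0⟩ := h (Abelian.Ext.mk₀ (ModuleCat.ofHom ε.toLinearMap))
  apply hs
  rw [← Abelian.Ext.mk₀_smul] at h0
  have h2 : s • ModuleCat.ofHom ε.toLinearMap = 0 :=
    Abelian.Ext.homEquiv₀.symm.injective (by simpa using h0)
  have h3 := congrArg (fun φ => φ.hom (ε.symm 1)) h2
  have h4 : s • ε (ε.symm 1) = 0 := h3
  simpa using h4


theorem height_finite {R : Type} [CommRing R] [IsNoetherianRing R] (q : PrimeSpectrum R) :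
    ∃ h : ℕ, Order.height q = h := by
  have h1 : Order.height q ≠ ⊤ := by
    rw [← PrimeSpectrum.height_eq_orderHeight]
    exact Ideal.height_ne_top_of_isPrime
  obtain ⟨h, hh⟩ := ENat.ne_top_iff_exists.1 h1
  exact ⟨h, hh.symm⟩

theorem height_nonvanishing {R : Type} [CommRing R] [IsNoetherianRing R]
    (hbot : (⊥ : Ideal R).IsPrime) (h : ℕ) :
    ∀ q : PrimeSpectrum R, Order.height q = h → ¬ W h q.asIdeal q.asIdeal := by
  induction h with
  | zero =>
    intro q hq
    have h1 : IsMin q := Order.height_eq_zero.1 (by simpa using hq)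
    have h2 : q.asIdeal = ⊥ :=
      le_bot_iff.1 (h1 (b := ⟨⊥, hbot⟩) (bot_le : (⊥ : Ideal R) ≤ q.asIdeal))
    rw [h2]
    exact bot_nonvanishing
  | succ h ih =>
    intro q hq
    obtain ⟨-, ⟨y, hyq, hy⟩, hall⟩ := Order.height_eq_coe_add_one_iff.1 (by simpa using hq)
    have := y.isPrime
    have := q.isPrime
    refine bass (q := y.asIdeal) (q' := q.asIdeal) hyq ?_ (ih y hy)
    intro r hr hyr hrq
    by_contra hne
    have h1 : (⟨r, hr⟩ : PrimeSpectrum R) < q := lt_of_le_of_ne hrq (fun h0 => hne (congrArg PrimeSpectrum.asIdeal h0))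
    have h2 : y < (⟨r, hr⟩ : PrimeSpectrum R) := hyr
    have h3 := hall _ h1
    have h4 := Order.height_strictMono h2 (by rw [hy]; exact ENat.natCast_lt_top h)
    rw [hy] at h4
    exact absurd h4 (not_lt.2 h3)

theorem going_up {R : Type} [CommRing R] [IsNoetherianRing R] [IsLocalRing R]
    (q : Ideal R) : q.IsPrime →
    ∃ s : ℕ, ∀ n, ¬ W n q q →
      ¬ W (n + s) (IsLocalRing.maximalIdeal R) (IsLocalRing.maximalIdeal R) := by
  induction q using WellFoundedGT.induction with
  | ind q ih =>
  intro hq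
  by_cases hm : q = IsLocalRing.maximalIdeal R
  · subst hm
    exact ⟨0, fun n hn => hn⟩
  · have hmp : (IsLocalRing.maximalIdeal R).IsPrime :=
      (IsLocalRing.maximalIdeal.isMaximal R).isPrime
    let T : Set (PrimeSpectrum R) := {r | q < r.asIdeal}
    have hT : T.Nonempty := ⟨⟨_, hmp⟩, lt_of_le_of_ne (IsLocalRing.le_maximalIdeal hq.ne_top) hm⟩
    obtain ⟨q', hq', hmin⟩ := (InvImage.wf (fun r : PrimeSpectrum R => Order.height r)
      (wellFounded_lt (α := ℕ∞))).has_min T hT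
    have := q'.isPrime
    obtain ⟨s, hs⟩ := ih q'.asIdeal hq' q'.isPrime
    refine ⟨1 + s, fun n hn => ?_⟩
    rw [← add_assoc]
    refine hs _ (bass (q := q) (q' := q'.asIdeal) hq' ?_ hn)
    intro r hr hqr hrq
    by_contra hne
    have h1 : (⟨r, hr⟩ : PrimeSpectrum R) < q' := lt_of_le_of_ne hrq (fun h0 => hne (congrArg PrimeSpectrum.asIdeal h0))
    refine hmin ⟨r, hr⟩ hqr (Order.height_strictMono h1 ?_)
    obtain ⟨k, hk⟩ := height_finite (⟨r, hr⟩ : PrimeSpectrum R)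
    rw [hk]
    exact ENat.natCast_lt_top k

theorem W_of_height_lt {R : Type} [CommRing R] [IsNoetherianRing R] [IsLocalRing R]
    (hreg : ∃ s : Finset R, Ideal.span (s : Set R) = IsLocalRing.maximalIdeal R ∧
      (s.card : WithBot ℕ∞) = ringKrullDim R) :
    (⊥ : Ideal R).IsPrime ∧ ∀ (q : PrimeSpectrum R) (h : ℕ), Order.height q = h →
      ∀ (J : Ideal R) (n : ℕ), h < n → W n q.asIdeal J := by
  obtain ⟨s, hs, hcard⟩ := hreg
  obtain ⟨hbot, hC⟩ := regChain_exists s.card (⊥ : Ideal R) s rfl (by rw [bot_sup_eq, hs])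
    (by rw [hcard, ringKrullDim_eq_of_ringEquiv (RingEquiv.quotientBot R)])
  refine ⟨hbot, fun q h hq => ?_⟩
  have := q.isPrime
  apply W.all h
  intro n hn
  by_contra hW
  obtain ⟨t, ht⟩ := going_up q.asIdeal q.isPrime
  have h1 := residue_nonvanishing hC (ht n hW)
  have h2 := residue_nonvanishing hC (ht h (height_nonvanishing hbot h q hq))
  omega

end PureCodim

open PureCodim in
theorem pure_codim_two_iff_ext_support (R : Type) [CommRing R] [IsNoetherianRing R]
    [IsLocalRing R]
    (hreg : ∃ s : Finset R, Ideal.span (s : Set R) = IsLocalRing.maximalIdeal R ∧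
      (s.card : WithBot ℕ∞) = ringKrullDim R)
    (I : Ideal R)
    (hmin : ∀ (p : Ideal R) (hp : p.IsPrime), p ∈ I.minimalPrimes →
      2 ≤ Order.height (⟨p, hp⟩ : PrimeSpectrum R)) :
    (∀ (p : Ideal R) (hp : p.IsPrime), p ∈ associatedPrimes R (R ⧸ I) →
      Order.height (⟨p, hp⟩ : PrimeSpectrum R) = 2) ↔
    (∀ n : ℕ, 3 ≤ n → ∀ (q : Ideal R) (hq : q.IsPrime),
      Nontrivial (LocalizedModule q.primeCompl
        (ExtGrp R (ModuleCat.of R (R ⧸ I)) (ModuleCat.of R R) n)) →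
      (n : ℕ∞) < Order.height (⟨q, hq⟩ : PrimeSpectrum R)) := by
  obtain ⟨hbot, hvan⟩ := W_of_height_lt hreg
  constructor
  · intro hass n hn q hq hnt
    have hW : ¬ W n q I := (ext_bridge R _ _ n (by omega) q).1 hnt
    obtain ⟨h, hh⟩ := height_finite (⟨q, hq⟩ : PrimeSpectrum R)
    rw [hh]
    by_contra hle
    have hle : h ≤ n := by exact_mod_cast not_lt.1 hle
    rcases hle.lt_or_eq with hlt | rfl
    · exact hW (hvan ⟨q, hq⟩ h hh I n hlt)
    · have hx : ∃ x ∈ q, ∀ r, r ∈ I ↔ x * r ∈ I := by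
        by_contra hno
        push Not at hno
        have hsub : (q : Set R) ⊆ ⋃ p ∈ associatedPrimes R (R ⧸ I), ((id p : Ideal R) : Set R) := by
          intro x hx
          have := biUnion_associatedPrimes_eq_zero_divisors R (R ⧸ I)
          simp only [id]
          rw [this]
          obtain ⟨r, hr⟩ := hno x hx
          rcases hr with ⟨h1, h2⟩ | ⟨h1, h2⟩
          · exact absurd (I.mul_mem_left x h1) h2
          · refine ⟨Ideal.Quotient.mk I r, fun h0 => h1 (Ideal.Quotient.eq_zero_iff_mem.1 h0), ?_⟩
            exact Ideal.Quotient.eq_zero_iff_mem.2 h2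
        obtain ⟨p, hp, hqp⟩ := (Ideal.subset_union_prime_finite
          (associatedPrimes.finite R (R ⧸ I)) ⊥ ⊥ (fun i hi _ _ => hi.isPrime)).1 hsub
        have h2 := hass p hp.isPrime hp
        have h3 : Order.height (⟨q, hq⟩ : PrimeSpectrum R) ≤
            Order.height (⟨p, hp.isPrime⟩ : PrimeSpectrum R) := Order.height_mono hqp
        rw [h2, hh] at h3
        have h4 : h ≤ 2 := by exact_mod_cast h3
        omega
      obtain ⟨x, hxq, hx⟩ := hx
      exact hW (W.nak hxq hx (hvan ⟨q, hq⟩ h hh _ _ (Nat.lt_succ_self h)))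
  · intro hext p hp hpa
    obtain ⟨-, x, hx⟩ := isAssociatedPrime_iff.1 hpa
    obtain ⟨a, rfl⟩ := Ideal.Quotient.mk_surjective x
    have hmem : ∀ r, r ∈ p ↔ a * r ∈ I := by
      intro r
      rw [hx, Submodule.mem_colon_singleton, Submodule.mem_bot, mul_comm]
      exact Ideal.Quotient.eq_zero_iff_mem (I := I) (a := r * a)
    have hIp : I ≤ p := fun r hr => (hmem r).2 (I.mul_mem_left a hr)
    obtain ⟨p₀, hp₀, hle⟩ := Ideal.exists_minimalPrimes_le hIp
    have h2 : 2 ≤ Order.height (⟨p, hp⟩ : PrimeSpectrum R) :=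
      (hmin p₀ hp₀.1.1 hp₀).trans (Order.height_mono (a := (⟨p₀, hp₀.1.1⟩ : PrimeSpectrum R)) hle)
    obtain ⟨h, hh⟩ := height_finite (⟨p, hp⟩ : PrimeSpectrum R)
    rw [hh] at h2 ⊢
    have h2' : 2 ≤ h := by exact_mod_cast h2
    by_contra hne
    have h3 : h ≠ 2 := by
      rintro rfl
      exact hne rfl
    have hWI : W h p I := by
      by_contra hW
      have h5 := hext h (by omega) p hp ((ext_bridge R _ _ h (by omega) p).2 hW)
      rw [hh] at h5
      exact lt_irrefl _ h5
    exact height_nonvanishing hbot h ⟨p, hp⟩ hh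
      (W.left hmem hWI (hvan ⟨p, hp⟩ h hh _ _ (Nat.lt_succ_self h)))
end

section
/- Let R be a commutative Noetherian regular local ring of Krull dimension ℓ with maximal ideal m, and let M be a finitely generated R-module. Then M_p is a free R_p-module for every prime ideal p ≠ m if and only if Ext^p_R(Ext^q_R(M, R), R) = 0 for all integers q > 0 and p < ℓ. -/
open CategoryTheory

section bridge
variable {R : Type} [CommRing R] {X : ModuleCat.{0} R} (Y : ModuleCat.{0} R) (P : ProjectiveResolution X) (n : ℕ)

lemma smul_extMk (f : P.complex.X n ⟶ Y) (m : ℕ) (hm : n + 1 = m)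
    (hf : P.complex.d m n ≫ f = 0) (r : R) :
    r • P.extMk f m hm hf = P.extMk (r • f) m hm (by simp [hf]) := by
  rw [Abelian.Ext.smul_eq_comp_mk₀, ProjectiveResolution.extMk_comp_mk₀]
  congr 1

lemma extMk_eq_zero_iff_zero (f : P.complex.X 0 ⟶ Y) (m : ℕ) (hm : 0 + 1 = m)
    (hf : P.complex.d m 0 ≫ f = 0) :
    P.extMk f m hm hf = 0 ↔ f = 0 := by
  constructor
  swap
  · rintro rfl; simp
  intro h
  simp only [← P.extEquivCohomologyClass.apply_eq_iff_eq,
    ProjectiveResolution.extEquivCohomologyClass_extMk, ProjectiveResolution.extEquivCohomologyClass_zero,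
    CochainComplex.HomComplex.CohomologyClass.mk_eq_zero_iff] at h
  rw [CochainComplex.HomComplex.Cocycle.toSingleMk_mem_coboundaries_iff _ _ _ _ _ 1 (by simp)] at h
  obtain ⟨g, hg⟩ := h
  have hz : Limits.IsZero (P.cochainComplex.X 1) := P.cochainComplex.isZero_of_isStrictlyLE 0 1 (by lia)
  rw [hz.eq_of_src g 0] at hg
  rw [← cancel_epi (P.cochainComplexXIso (-(0:ℕ)) 0 rfl).hom]
  rw [← hg]; simp

lemma cyc_aux (f : LinearMap.ker ((P.complex.linearYonedaObj R Y).sc n).g.hom) :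
    P.complex.d (n+1) n ≫ (show P.complex.X n ⟶ Y from f.1) = 0 := by
  have h : ((P.complex.linearYonedaObj R Y).d n ((ComplexShape.up ℕ).next n)).hom f.1 = 0 := f.2
  have h2 : (ComplexShape.up ℕ).next n = n + 1 := CochainComplex.next _ n
  rw [h2] at h
  exact h

noncomputable def cyclesToExt :
    LinearMap.ker ((P.complex.linearYonedaObj R Y).sc n).g.hom →ₗ[R] Abelian.Ext X Y n where
  toFun f := P.extMk (show P.complex.X n ⟶ Y from f.1) (n+1) rfl (cyc_aux Y P n f)
  map_add' f g :=
    (P.add_extMk (Y := Y) f.1 g.1 (n+1) rfl (cyc_aux Y P n f) (cyc_aux Y P n g)).symm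
  map_smul' r f := (smul_extMk Y P n f.1 (n+1) rfl (cyc_aux Y P n f) r).symm

lemma cyclesToExt_surjective : Function.Surjective (cyclesToExt Y P n) := by
  intro a
  obtain ⟨f, hf, rfl⟩ := P.extMk_surjective a (n+1) rfl
  refine ⟨⟨f, ?_⟩, rfl⟩
  show ((P.complex.linearYonedaObj R Y).d n ((ComplexShape.up ℕ).next n)).hom f = 0
  have h2 : (ComplexShape.up ℕ).next n = n + 1 := CochainComplex.next _ n
  rw [h2]
  exact hf

lemma cyclesToExt_ker : LinearMap.ker (cyclesToExt Y P n) =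
    LinearMap.range ((P.complex.linearYonedaObj R Y).sc n).moduleCatToCycles := by
  ext ⟨f, hf⟩
  rw [LinearMap.mem_ker]
  have key : (⟨f, hf⟩ ∈ LinearMap.range ((P.complex.linearYonedaObj R Y).sc n).moduleCatToCycles) ↔
     ∃ g, ((P.complex.linearYonedaObj R Y).d ((ComplexShape.up ℕ).prev n) n).hom g = f := by
    simp only [LinearMap.mem_range, Subtype.ext_iff]
    rfl
  rw [key]
  cases n with
  | zero =>
    refine (extMk_eq_zero_iff_zero Y P f _ rfl (cyc_aux Y P 0 ⟨f,hf⟩)).trans ?_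
    have : ((P.complex.linearYonedaObj R Y).d ((ComplexShape.up ℕ).prev 0) 0) = 0 := by
      apply HomologicalComplex.shape
      simp
    rw [this]
    constructor
    · rintro rfl; exact ⟨0, rfl⟩
    · rintro ⟨g, rfl⟩; rfl
  | succ n =>
    have h2 : (ComplexShape.up ℕ).prev (n+1) = n := by simp
    rw [h2]
    exact (P.extMk_eq_zero_iff f _ rfl (cyc_aux Y P (n+1) ⟨f,hf⟩) n rfl)

noncomputable def extGrpEquiv (X : ModuleCat.{0} R) : ExtGrp R X Y n ≃ₗ[R] Abelian.Ext X Y n :=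
  let P := projectiveResolution X
  (P.isoExt n Y ≪≫ ((P.complex.linearYonedaObj R Y).sc n).moduleCatHomologyIso).toLinearEquiv ≪≫ₗ
   (Submodule.quotEquivOfEq _ _ (cyclesToExt_ker Y P n).symm) ≪≫ₗ
    (cyclesToExt Y P n).quotKerEquivOfSurjective (cyclesToExt_surjective Y P n)
end bridge

section reg
open IsLocalRing RingTheory.Sequence

lemma exch_gen {R : Type} [CommRing R] [IsLocalRing R] (n : ℕ) (v : Fin (n+1) → R)
    (hv : Ideal.span (Set.range v) = maximalIdeal R) (x : R) (hx : x ∈ maximalIdeal R)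
    (hx2 : x ∉ maximalIdeal R ^ 2) :
    ∃ w : Fin n → R, Ideal.span {x} ⊔ Ideal.span (Set.range w) = maximalIdeal R := by
  have hvm : ∀ i, v i ∈ maximalIdeal R := fun i => hv ▸ Ideal.subset_span ⟨i, rfl⟩
  have hx' := hx
  rw [← hv, Ideal.mem_span_range_iff_exists_fun] at hx'
  obtain ⟨a, ha⟩ := hx'
  have : ∃ i, a i ∉ maximalIdeal R := by
    by_contra! h
    apply hx2
    rw [← ha, pow_two]
    exact Ideal.sum_mem _ fun i _ => Ideal.mul_mem_mul (h i) (hvm i)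
  obtain ⟨i, hi⟩ := this
  have hu : IsUnit (a i) := by simpa using hi
  obtain ⟨b, hb⟩ := hu.exists_left_inv
  refine ⟨v ∘ i.succAbove, le_antisymm ?_ ?_⟩
  · rw [sup_le_iff, Ideal.span_le, Ideal.span_le]
    refine ⟨by simpa using hx, ?_⟩
    rintro _ ⟨j, rfl⟩
    exact hvm _
  · conv_lhs => rw [← hv]
    rw [Ideal.span_le]
    rintro _ ⟨j, rfl⟩
    have hw : ∀ k, v (i.succAbove k) ∈ Ideal.span {x} ⊔ Ideal.span (Set.range (v ∘ i.succAbove)) :=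
      fun k => Ideal.mem_sup_right (Ideal.subset_span ⟨k, rfl⟩)
    rcases Fin.eq_self_or_eq_succAbove i j with rfl | ⟨k, rfl⟩
    · rw [Fin.sum_univ_succAbove _ j] at ha
      have : v j = b * (x - ∑ k, a (j.succAbove k) * v (j.succAbove k)) := by
        rw [← ha]
        linear_combination (-v j) * hb
      rw [this]
      refine Ideal.mul_mem_left _ _ (Ideal.sub_mem _ ?_ ?_)
      · exact Ideal.mem_sup_left (Ideal.mem_span_singleton_self x)
      · exact Ideal.sum_mem _ fun k _ => Ideal.mul_mem_left _ _ (hw k)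
    · exact hw k

lemma spanFinrank_le_of_fin {R : Type} [CommRing R] (n : ℕ) (v : Fin n → R) :
    (Ideal.span (Set.range v)).spanFinrank ≤ n := by
  refine (Submodule.spanFinrank_span_le_ncard_of_finite (Set.finite_range v)).trans ?_
  rw [← Set.image_univ]
  refine (Set.ncard_image_le (Set.finite_univ)).trans ?_
  simp

lemma exists_good_elt {R : Type} [CommRing R] [IsNoetherianRing R] [IsLocalRing R] (n : ℕ)
    (hdim : ringKrullDim R = (n + 1 : ℕ)) :
    ∃ x ∈ maximalIdeal R, x ∉ maximalIdeal R ^ 2 ∧ ∀ P ∈ minimalPrimes R, x ∉ P := by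
  by_contra! h
  classical
  have hht : (maximalIdeal R).height = (n + 1 : ℕ) := by
    have := IsLocalRing.maximalIdeal_height_eq_ringKrullDim (R := R)
    rw [hdim] at this
    exact_mod_cast this
  have hnm : maximalIdeal R ∉ minimalPrimes R := by
    intro hm
    rw [← Ideal.height_eq_zero_iff, hht] at hm
    simp at hm
  let fin := minimalPrimes.finite_of_isNoetherianRing R
  let s : Finset (Ideal R) := insert (maximalIdeal R ^ 2) fin.toFinset
  have := (Ideal.subset_union_prime (s := s) (f := id) (maximalIdeal R ^ 2) (maximalIdeal R ^ 2)
    (I := maximalIdeal R) (by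
      intro i hi h1 _
      simp only [s, Finset.mem_insert, h1, false_or, Set.Finite.mem_toFinset] at hi
      exact hi.1.1)).1 (by
      intro x hx
      by_cases hx2 : x ∈ maximalIdeal R ^ 2
      · simp only [Set.mem_iUnion]
        exact ⟨_, by simp [s], hx2⟩
      · obtain ⟨P, hP, hxP⟩ := h x hx hx2
        simp only [Set.mem_iUnion]
        exact ⟨P, by simp [s, fin, hP], hxP⟩)
  obtain ⟨P, hP, hle⟩ := this
  simp only [s, Finset.mem_insert, Set.Finite.mem_toFinset] at hP
  rcases hP with rfl | hP
  · have : maximalIdeal R = ⊥ := by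
      apply Submodule.eq_bot_of_le_smul_of_le_jacobson_bot (maximalIdeal R) _
        (IsNoetherian.noetherian _)
      · simpa [pow_two] using hle
      · exact IsLocalRing.maximalIdeal_le_jacobson _
    have h0 : (maximalIdeal R).height = 0 := by rw [this, Ideal.height_bot]
    rw [hht] at h0
    simp at h0
  · have hpr : P.IsPrime := hP.1.1
    have := (IsLocalRing.maximalIdeal.isMaximal R).eq_of_le hpr.ne_top hle
    exact hnm (this ▸ hP)

lemma domain_of_quot {R : Type} [CommRing R] [IsNoetherianRing R] [IsLocalRing R] (x : R)
    (hx : x ∈ maximalIdeal R) (hP : ∀ P ∈ minimalPrimes R, x ∉ P) [IsDomain (R ⧸ Ideal.span {x})] :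
    IsDomain R := by
  have hpr : (Ideal.span {x}).IsPrime := (Ideal.Quotient.isDomain_iff_prime _).1 ‹_›
  obtain ⟨P, hPm, hle⟩ := Ideal.exists_minimalPrimes_le (I := (⊥ : Ideal R)) (J := Ideal.span {x}) bot_le
  have hPp : P.IsPrime := hPm.1.1
  have hxP := hP P hPm
  have : P = ⊥ := by
    apply Submodule.eq_bot_of_le_smul_of_le_jacobson_bot (maximalIdeal R) _
        (IsNoetherian.noetherian _)
    · intro y hy
      obtain ⟨a, rfl⟩ := Ideal.mem_span_singleton'.1 (hle hy)
      rcases hPp.mem_or_mem hy with h | h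
      · rw [mul_comm]
        exact Ideal.mul_mem_mul hx h
      · exact absurd h hxP
    · exact IsLocalRing.maximalIdeal_le_jacobson _
  subst this
  exact IsDomain.of_bot_isPrime R

theorem reg_main (n : ℕ) : ∀ (R : Type) [CommRing R] [IsNoetherianRing R] [IsLocalRing R],
    ringKrullDim R = n → (∃ v : Fin n → R, Ideal.span (Set.range v) = maximalIdeal R) →
    IsDomain R ∧ ∃ rs : List R, rs.length = n ∧ Ideal.ofList rs = maximalIdeal R ∧ IsRegular R rs := by
  induction n with
  | zero =>
    intro R _ _ _ hdim ⟨v, hv⟩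
    have hm : maximalIdeal R = ⊥ := by rw [← hv]; simp
    have hf : IsField R := IsLocalRing.isField_iff_maximalIdeal_eq.2 hm
    refine ⟨hf.isDomain, [], rfl, by simp [hm], ?_⟩
    simp [isRegular_iff]
  | succ n ih =>
    intro R _ _ _ hdim ⟨v, hv⟩
    obtain ⟨x, hx, hx2, hxP⟩ := exists_good_elt n hdim
    obtain ⟨w, hw⟩ := exch_gen n v hv x hx hx2
    let q := Ideal.Quotient.mk (Ideal.span {x})
    have hne : Ideal.span {x} ≠ ⊤ := by
      intro h
      rw [Ideal.span_singleton_eq_top] at h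
      exact hx h
    have : Nontrivial (R ⧸ Ideal.span {x}) := Ideal.Quotient.nontrivial_iff.2 hne
    have hloc : IsLocalRing (R ⧸ Ideal.span {x}) := .of_surjective' q Ideal.Quotient.mk_surjective
    have hmap : (maximalIdeal R).map q = maximalIdeal (R ⧸ Ideal.span {x}) := 
      IsLocalRing.map_maximalIdeal_of_surjective q Ideal.Quotient.mk_surjective
    have hgen : Ideal.span (Set.range (q ∘ w)) = maximalIdeal (R ⧸ Ideal.span {x}) := by
      rw [← hmap, ← hw, Ideal.map_sup, Ideal.map_span, Ideal.map_span, Set.range_comp]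
      simp [q, Ideal.Quotient.eq_zero_iff_mem.2 (Ideal.mem_span_singleton_self x)]
    have hd : ringKrullDim (R ⧸ Ideal.span {x}) = n := by
      apply le_antisymm
      · refine (ringKrullDim_le_spanFinrank_maximalIdeal _).trans ?_
        rw [← hgen]
        exact_mod_cast spanFinrank_le_of_fin _ _
      · have h1 := ringKrullDim_le_ringKrullDim_quotSMulTop_succ hx
        rw [← Submodule.ideal_span_singleton_smul, smul_eq_mul, Ideal.mul_top, hdim] at h1
        push_cast at h1
        exact (ENat.WithBot.add_le_add_natCast_right_iff (c := 1)).1 (by exact_mod_cast h1)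
    obtain ⟨hdom, rs, hlen, hrs, hreg⟩ := ih _ hd ⟨_, hgen⟩
    have hD := domain_of_quot x hx hxP
    obtain ⟨rs', rfl⟩ : ∃ rs' : List R, rs'.map q = rs :=
      List.map_surjective_iff.2 Ideal.Quotient.mk_surjective rs
    refine ⟨hD, x :: rs', by simpa using hlen, ?_, ?_⟩
    · rw [Ideal.ofList_cons]
      rw [← Ideal.map_ofList, ← hmap] at hrs
      have := congrArg (Ideal.comap q) hrs
      rw [Ideal.comap_map_of_surjective q Ideal.Quotient.mk_surjective,
        Ideal.comap_map_of_surjective q Ideal.Quotient.mk_surjective] at this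
      have hk : Ideal.comap q ⊥ = Ideal.span {x} := by
        rw [← RingHom.ker_eq_comap_bot]; exact Ideal.mk_ker
      rw [hk] at this
      rw [sup_comm, this]
      exact sup_eq_left.2 ((Ideal.span_singleton_le_iff_mem _).2 hx)
    · rw [isRegular_cons_iff']
      have hx0 : x ≠ 0 := by rintro rfl; exact hx2 (Ideal.zero_mem _)
      refine ⟨?_, ?_⟩
      · intro a b h
        exact mul_left_cancel₀ hx0 h
      · have e : QuotSMulTop x R ≃ₗ[R] (R ⧸ Ideal.span {x}) := 
          Submodule.quotEquivOfEq _ _ (by rw [← Submodule.ideal_span_singleton_smul]; simp)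
        exact ((e.extendScalarsOfSurjective
          Ideal.Quotient.mk_surjective).isRegular_congr _).2 hreg

end reg

section fpd
open IsLocalRing RingTheory.Sequence

/-- Finite projective dimension. -/
def FPD (R : Type) [CommRing R] (M : Type) [AddCommGroup M] [Module R M] : Prop :=
  ∃ n : ℕ, HasProjectiveDimensionLT (ModuleCat.of R M) n

variable {R : Type} [CommRing R]

lemma FPD.of_equiv {M N : Type} [AddCommGroup M] [Module R M] [AddCommGroup N] [Module R N]
    (e : M ≃ₗ[R] N) (h : FPD R M) : FPD R N := by
  obtain ⟨n, h⟩ := h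
  exact ⟨n, hasProjectiveDimensionLT_of_iso e.toModuleIso n⟩

lemma FPD.of_exact {N₁ N₂ N₃ : Type} [AddCommGroup N₁] [Module R N₁] [AddCommGroup N₂] [Module R N₂]
    [AddCommGroup N₃] [Module R N₃] (f : N₁ →ₗ[R] N₂) (g : N₂ →ₗ[R] N₃)
    (hf : Function.Injective f) (hg : Function.Surjective g) (hfg : Function.Exact f g)
    (h1 : FPD R N₁) (h3 : FPD R N₃) : FPD R N₂ := by
  obtain ⟨n, hn⟩ := h1
  obtain ⟨m, hm⟩ := h3
  let S : ShortComplex (ModuleCat R) := ShortComplex.mk (ModuleCat.ofHom f) (ModuleCat.ofHom g)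
    (by ext x; exact hfg.apply_apply_eq_zero x)
  have hS : S.ShortExact := by
    refine ShortComplex.ShortExact.mk' ((ShortComplex.ShortExact.moduleCat_exact_iff_function_exact S).2 hfg) ?_ ?_
    · exact (ModuleCat.mono_iff_injective _).2 hf
    · exact (ModuleCat.epi_iff_surjective _).2 hg
  refine ⟨max n m, hS.hasProjectiveDimensionLT_X₂ (max n m) ?_ ?_⟩
  · exact hasProjectiveDimensionLT_of_ge _ n _ (le_max_left _ _)
  · exact hasProjectiveDimensionLT_of_ge _ m _ (le_max_right _ _)

lemma FPD.of_subsingleton {M : Type} [AddCommGroup M] [Module R M] [Subsingleton M] : FPD R M :=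
  ⟨0, (ModuleCat.isZero_of_subsingleton _).hasProjectiveDimensionLT_zero⟩

lemma FPD.iff_ne_top {M : Type} [AddCommGroup M] [Module R M] :
    FPD R M ↔ projectiveDimension (ModuleCat.of R M) ≠ ⊤ := by
  rw [projectiveDimension_ne_top_iff]
  constructor
  · rintro ⟨n, h⟩
    exact ⟨n, hasProjectiveDimensionLT_of_ge _ n _ (Nat.le_succ n)⟩
  · rintro ⟨n, h⟩
    exact ⟨n + 1, h⟩

lemma mem_supp_quot (p : Ideal R) (q : PrimeSpectrum R) :
    q ∈ Module.support R (R ⧸ p) ↔ p ≤ q.asIdeal := by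
  rw [Module.mem_support_iff_of_finite, Ideal.annihilator_quotient]

lemma fpd_of_supp [IsNoetherianRing R] (p : Ideal R) 
    (h : ∀ q : Ideal R, q.IsPrime → p < q → FPD R (R ⧸ q)) 
    (M : Type) [AddCommGroup M] [Module R M] [hM : Module.Finite R M] 
    (hs : ∀ q ∈ Module.support R M, p < q.asIdeal) : FPD R M := by
  revert hs
  refine IsNoetherianRing.induction_on_isQuotientEquivQuotientPrime R hM 
    (motive := fun M _ _ _ => (∀ q ∈ Module.support R M, p < q.asIdeal) → FPD R M) ?_ ?_ ?_
  · intros; exact FPD.of_subsingleton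
  · intro N _ _ _ q e hs
    refine FPD.of_equiv e.symm (h q.1 q.2 (hs q ?_))
    rw [e.support_eq, mem_supp_quot]
  · intro N₁ _ _ _ N₂ _ _ _ N₃ _ _ _ f g hf hg hfg h1 h3 hs
    refine FPD.of_exact f g hf hg hfg (h1 ?_) (h3 ?_)
    · exact fun q hq => hs q (Module.support_subset_of_injective f hf hq)
    · exact fun q hq => hs q (Module.support_subset_of_surjective g hg hq)

lemma fpd_all [IsNoetherianRing R] [IsLocalRing R] (rs : List R) (hrs : Ideal.ofList rs = maximalIdeal R)
    (hreg : IsRegular R rs) (M : Type) [AddCommGroup M] [Module R M] [hM : Module.Finite R M] :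
    FPD R M := by
  have key : ∀ q : Ideal R, q.IsPrime → FPD R (R ⧸ q) := by
    intro p
    induction p using (wellFounded_gt (α := Ideal R)).induction with
    | _ p ih =>
    intro hp
    by_cases hpm : p = maximalIdeal R
    · subst hpm
      have := ModuleCat.projectiveDimension_quotient_eq_length.{0} rs hreg
      have h2 : FPD R (Shrink.{0} (R ⧸ Ideal.ofList rs)) := by
        rw [FPD.iff_ne_top, this]
        intro h
        exact ENat.natCast_ne_top rs.length (WithBot.coe_injective h)
      rw [← hrs]
      exact h2.of_equiv (Shrink.linearEquiv R _)
    · have hle : p ≤ maximalIdeal R := le_maximalIdeal hp.ne_top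
      obtain ⟨x, hx, hxp⟩ := SetLike.exists_of_lt (lt_of_le_of_ne hle hpm)
      have hreg : IsSMulRegular (R ⧸ p) x := by
        intro a b hab
        have : (Ideal.Quotient.mk p x) * a = Ideal.Quotient.mk p x * b := by
          simpa [Algebra.smul_def] using hab
        exact mul_left_cancel₀ (by rwa [Ne, Ideal.Quotient.eq_zero_iff_mem]) this
      have h1 : FPD R (QuotSMulTop x (R ⧸ p)) := by
        refine fpd_of_supp p (fun q hq hlt => ih q hlt hq) _ ?_
        intro q hq
        have h1 : q ∈ Module.support R (R ⧸ p) :=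
          Module.support_subset_of_surjective (Submodule.mkQ _) (Submodule.mkQ_surjective _) hq
        rw [mem_supp_quot] at h1
        have h2 : x ∈ q.asIdeal := by
          have := (Module.mem_support_iff_of_finite.1 hq)
          apply this
          rw [Module.mem_annihilator]
          intro m
          obtain ⟨m, rfl⟩ := Submodule.mkQ_surjective _ m
          rw [← map_smul]
          simp only [Submodule.mkQ_apply, Submodule.Quotient.mk_eq_zero]
          exact Submodule.smul_mem_pointwise_smul _ _ _ trivial
        exact lt_of_le_of_ne h1 (fun h => hxp (h ▸ h2))
      rw [FPD.iff_ne_top] at h1 ⊢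
      have h2 := ModuleCat.projectiveDimension_quotSMulTop_eq_succ_of_isSMulRegular 
        (ModuleCat.of R (R ⧸ p)) x hreg hx
      intro h3
      apply h1
      rw [h2, h3]
      rfl
  refine IsNoetherianRing.induction_on_isQuotientEquivQuotientPrime R hM 
    (motive := fun M _ _ _ => FPD R M) ?_ ?_ ?_
  · intros; exact FPD.of_subsingleton
  · intro N _ _ _ q e
    exact FPD.of_equiv e.symm (key q.1 q.2)
  · intro N₁ _ _ _ N₂ _ _ _ N₃ _ _ _ f g hf hg hfg h1 h3
    exact FPD.of_exact f g hf hg hfg h1 h3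

end fpd

section factor
variable {R : Type} [CommRing R]

lemma factor_of_free [IsNoetherianRing R] (p : Ideal R) [p.IsPrime]
    (M : Type) [AddCommGroup M] [Module R M] [Module.Finite R M]
    [Module.Free (Localization.AtPrime p) (LocalizedModule p.primeCompl M)] :
    ∃ (k : ℕ) (φ : M →ₗ[R] (Fin k → R)) (ψ : (Fin k → R) →ₗ[R] M) (s : R), s ∉ p ∧
      ψ ∘ₗ φ = s • LinearMap.id := by
  let S := p.primeCompl
  let b := Module.finBasis (Localization.AtPrime p) (LocalizedModule p.primeCompl M)
  let k := Module.finrank (Localization.AtPrime p) (LocalizedModule p.primeCompl M)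
  let e : LocalizedModule p.primeCompl M ≃ₗ[R] (Fin k → Localization.AtPrime p) :=
    b.equivFun.restrictScalars R
  let f := LocalizedModule.mkLinearMap S M
  let g : (Fin k → R) →ₗ[R] (Fin k → Localization.AtPrime p) :=
    .pi fun i => (Algebra.linearMap R (Localization.AtPrime p)) ∘ₗ .proj i
  have : IsLocalizedModule S g := inferInstance
  have : Module.FinitePresentation R M := Module.finitePresentation_of_finite R M
  obtain ⟨φ, s, hφ⟩ := Module.FinitePresentation.exists_lift_of_isLocalizedModule S g
    (e.toLinearMap ∘ₗ f)
  obtain ⟨ψ, t, hψ⟩ := Module.FinitePresentation.exists_lift_of_isLocalizedModule S f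
    (e.symm.toLinearMap ∘ₗ g)
  have H : f ∘ₗ (ψ ∘ₗ φ) = f ∘ₗ ((t * s) • LinearMap.id) := by
    ext a
    have h1 := LinearMap.congr_fun hψ (φ a)
    have h2 := LinearMap.congr_fun hφ a
    simp only [LinearMap.comp_apply, LinearMap.smul_apply, LinearEquiv.coe_coe] at h1 h2 ⊢
    rw [h1, h2]
    simp [Submonoid.smul_def, mul_smul]
  obtain ⟨u, hu⟩ := Module.Finite.exists_smul_of_comp_eq_of_isLocalizedModule S f _ _ H
  refine ⟨k, φ, u • ψ, (u * (t * s) : S), (u * (t * s)).2, ?_⟩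
  rw [LinearMap.smul_comp, hu]
  simp [Submonoid.smul_def, mul_smul]

lemma free_of_factor [IsNoetherianRing R] (p : Ideal R) [p.IsPrime]
    (M : Type) [AddCommGroup M] [Module R M] [Module.Finite R M]
    (F : Type) [AddCommGroup F] [Module R F] [Module.Free R F]
    (φ : M →ₗ[R] F) (ψ : F →ₗ[R] M) (s : R) (hs : s ∉ p) (h : ψ ∘ₗ φ = s • LinearMap.id) :
    Module.Free (Localization.AtPrime p) (LocalizedModule p.primeCompl M) := by
  let S := p.primeCompl
  have hF : Module.Free (Localization.AtPrime p) (LocalizedModule p.primeCompl F) := 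
    Module.free_of_isLocalizedModule S (LocalizedModule.mkLinearMap S F)
  have h1 : LocalizedModule.map S ψ ∘ₗ LocalizedModule.map S φ = 
    (algebraMap R (Localization.AtPrime p) s) • LinearMap.id := by
    ext x
    induction x using LocalizedModule.induction_on with
    | h m t =>
      have := LinearMap.congr_fun h m
      simp only [LinearMap.comp_apply, LinearMap.smul_apply, LinearMap.id_apply] at this
      simp [LocalizedModule.map_mk, this]
      rw [LocalizedModule.smul'_mk]
  obtain ⟨u, hu⟩ := IsLocalization.map_units (M := S) (Localization.AtPrime p) ⟨s, hs⟩
  have : Module.Projective (Localization.AtPrime p) (LocalizedModule p.primeCompl M) := by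
    refine Module.Projective.of_split (((u⁻¹ : _ˣ) : Localization.AtPrime p) • LocalizedModule.map S φ) 
      (LocalizedModule.map S ψ) ?_
    rw [LinearMap.comp_smul, h1, ← hu, smul_smul]
    simp
  exact Module.free_of_flat_of_isLocalRing
end factor

section kill
open Abelian
variable {R : Type} [CommRing R]

lemma ext_kill_of_factor {M F : Type} [AddCommGroup M] [Module R M] [AddCommGroup F] [Module R F]
    [Module.Projective R F] (φ : M →ₗ[R] F) (ψ : F →ₗ[R] M) (s : R) 
    (h : ψ ∘ₗ φ = s • LinearMap.id) (N : ModuleCat R) (q : ℕ) (hq : 0 < q)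
    (x : Ext (ModuleCat.of R M) N q) : s • x = 0 := by
  have h1 : ModuleCat.ofHom φ ≫ ModuleCat.ofHom ψ = s • 𝟙 (ModuleCat.of R M) := by
    rw [← ModuleCat.ofHom_comp, h]; rfl
  have : Projective (ModuleCat.of R F) := inferInstance
  obtain ⟨q, rfl⟩ := Nat.exists_eq_succ_of_ne_zero hq.ne'
  calc s • x = (s • Ext.mk₀ (𝟙 (ModuleCat.of R M))).comp x (zero_add _) := by
        rw [Ext.smul_comp, Ext.mk₀_id_comp]
    _ = (Ext.mk₀ (ModuleCat.ofHom φ)).comp ((Ext.mk₀ (ModuleCat.ofHom ψ)).comp x (zero_add _)) 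
        (zero_add _) := by
      rw [← Ext.mk₀_smul, ← h1, Ext.mk₀_comp_mk₀_assoc]
    _ = 0 := by
      rw [Ext.eq_zero_of_projective ((Ext.mk₀ (ModuleCat.ofHom ψ)).comp x (zero_add _)), Ext.comp_zero]

lemma ext_kill_free (M : ModuleCat R) (s : R) (q : ℕ) 
    (h : ∀ x : Ext M (ModuleCat.of R R) q, s • x = 0)
    (F : Type) [AddCommGroup F] [Module R F] [Module.Free R F] [Module.Finite R F]
    (x : Ext M (ModuleCat.of R F) q) : s • x = 0 := by
  let b := Module.Free.chooseBasis R F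
  let pr (i) : ModuleCat.of R F ⟶ ModuleCat.of R R := ModuleCat.ofHom (b.coord i)
  let inj (i) : ModuleCat.of R R ⟶ ModuleCat.of R F := ModuleCat.ofHom (LinearMap.toSpanSingleton R F (b i))
  have h1 : 𝟙 (ModuleCat.of R F) = ∑ i, pr i ≫ inj i := by
    ext y
    simp [pr, inj, ModuleCat.hom_sum]
  have h2 : s • x = ∑ i, (s • x.comp (Ext.mk₀ (pr i)) (add_zero _)).comp (Ext.mk₀ (inj i)) (add_zero _) := by
    conv_lhs => rw [← Ext.comp_mk₀_id x, h1, Ext.mk₀_sum, Ext.comp_sum, Finset.smul_sum]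
    refine Finset.sum_congr rfl fun i _ => ?_
    rw [Ext.smul_comp, Ext.comp_assoc_of_third_deg_zero, Ext.mk₀_comp_mk₀]
  rw [h2]
  refine Finset.sum_eq_zero fun i _ => ?_
  rw [h, Ext.zero_comp]

lemma ext_kill_all [IsNoetherianRing R] (p : Ideal R) [hp : p.IsPrime] (M : ModuleCat R) (n : ℕ)
    (hn : HasProjectiveDimensionLT M n)
    (h : ∀ q > 0, ∃ s ∉ p, ∀ x : Ext M (ModuleCat.of R R) q, s • x = 0) (k : ℕ) :
    ∀ q > 0, n ≤ q + k → ∃ s ∉ p, ∀ (N : Type) [AddCommGroup N] [Module R N] [Module.Finite R N]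
      (x : Ext M (ModuleCat.of R N) q), s • x = 0 := by
  induction k with
  | zero =>
    intro q hq hnq
    refine ⟨1, fun h => hp.ne_top ((Ideal.eq_top_iff_one _).2 h), fun N _ _ _ x => ?_⟩
    have := HasProjectiveDimensionLT.subsingleton M n q hnq (ModuleCat.of R N)
    exact Subsingleton.elim _ _
  | succ k ih =>
    intro q hq hnq
    obtain ⟨s, hs, hsx⟩ := h q hq
    obtain ⟨t, ht, htx⟩ := ih (q + 1) (by omega) (by omega)
    refine ⟨s * t, fun h => (hp.mem_or_mem h).elim hs ht, fun N _ _ _ x => ?_⟩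
    obtain ⟨F, _, _, _, _, f, hf⟩ := Module.exists_finite_presentation R N
    let S := f.shortComplexKer
    have hS : S.ShortExact := LinearMap.shortExact_shortComplexKer hf
    have h1 : (t • x).comp hS.extClass rfl = 0 := by
      rw [Ext.smul_comp]
      exact htx (LinearMap.ker f) _
    obtain ⟨y, hy⟩ := Ext.covariant_sequence_exact₃ M hS (t • x) rfl h1
    rw [mul_smul, ← hy, ← Ext.smul_comp, ext_kill_free M s q hsx F y, Ext.zero_comp]

lemma free_of_kill [IsNoetherianRing R] (M : Type) [AddCommGroup M] [Module R M] [Module.Finite R M] 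
    (s : R) (h : ∀ (N : Type) [AddCommGroup N] [Module R N] [Module.Finite R N]
      (x : Ext (ModuleCat.of R M) (ModuleCat.of R N) 1), s • x = 0) :
    ∃ (F : Type) (_ : AddCommGroup F) (_ : Module R F) (_ : Module.Free R F) 
      (φ : M →ₗ[R] F) (ψ : F →ₗ[R] M), ψ ∘ₗ φ = s • LinearMap.id := by
  obtain ⟨F, _, _, _, _, f, hf⟩ := Module.exists_finite_presentation R M
  let S := f.shortComplexKer
  have hS : S.ShortExact := LinearMap.shortExact_shortComplexKer hf
  have h1 : (Ext.mk₀ (s • 𝟙 (ModuleCat.of R M))).comp hS.extClass rfl = 0 := by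
    rw [Ext.mk₀_smul, Ext.smul_comp]
    exact h (LinearMap.ker f) _
  obtain ⟨y, hy⟩ := Ext.covariant_sequence_exact₃ (ModuleCat.of R M) hS (Ext.mk₀ (s • 𝟙 (ModuleCat.of R M))) rfl h1
  obtain ⟨y, rfl⟩ := (Ext.mk₀_bijective _ _).2 y
  rw [Ext.mk₀_comp_mk₀] at hy
  have := (Ext.mk₀_bijective _ _).1 hy
  refine ⟨F, _, _, inferInstance, y.hom, f, ?_⟩
  exact congrArg ModuleCat.Hom.hom this
end kill

section final
open IsLocalRing RingTheory.Sequence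

lemma finite_extGrp {R : Type} [CommRing R] [IsNoetherianRing R] (M N : ModuleCat R)
    [Module.Finite R M] [Module.Finite R N] (q : ℕ) : Module.Finite R (ExtGrp R M N q) := by
  have : Module.Finite R (Abelian.Ext M N q) := ModuleCat.finite_ext R M N q
  exact Module.Finite.equiv (extGrpEquiv N q M).symm

lemma not_le_of_vanish {R : Type} [CommRing R] [IsNoetherianRing R] [IsLocalRing R] (ℓ : ℕ)
    (hdim : ringKrullDim R = ℓ) (E : ModuleCat R) [Module.Finite R E]
    (h : ∀ i < ℓ, Subsingleton (Abelian.Ext E (ModuleCat.of R R) i)) (p : Ideal R) (hp : p.IsPrime)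
    (hpm : p ≠ maximalIdeal R) : ¬ Module.annihilator R E ≤ p := by
  intro hle
  have hlt : Module.annihilator R E • (⊤ : Submodule R (ModuleCat.of R R)) < ⊤ := by
    have : Module.annihilator R E • (⊤ : Submodule R R) < ⊤ := by
      rw [smul_eq_mul, Ideal.mul_top]
      exact lt_top_iff_ne_top.2 (fun h => hp.ne_top (top_le_iff.1 (h ▸ hle)))
    exact this
  obtain ⟨rs, hlen, hmem, hreg⟩ := ModuleCat.exists_isRegular_of_exists_subsingleton_ext
    (Module.annihilator R E) ℓ (ModuleCat.of R R) hlt E (Module.support_eq_zeroLocus) h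
  have h1 := ringKrullDim_add_length_eq_ringKrullDim_of_isRegular rs hreg
  rw [hlen, hdim] at h1
  have hle2 : Ideal.ofList rs ≤ p := Ideal.span_le.2 fun r hr => hle (hmem r hr)
  have h2 : ringKrullDim (R ⧸ Ideal.ofList rs) ≤ 0 := by
    refine (ENat.WithBot.add_le_add_natCast_right_iff (c := ℓ)).1 ?_
    rw [h1]; simp
  have h3 : Ring.KrullDimLE 0 (R ⧸ Ideal.ofList rs) := by
    rw [Ring.krullDimLE_iff]; exact_mod_cast h2
  have : (p.map (Ideal.Quotient.mk (Ideal.ofList rs))).IsPrime :=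
    Ideal.map_isPrime_of_surjective Ideal.Quotient.mk_surjective (by rwa [Ideal.mk_ker])
  have hmax : (p.map (Ideal.Quotient.mk (Ideal.ofList rs))).IsMaximal := Ideal.IsPrime.isMaximal' this
  have h4 := Ideal.comap_isMaximal_of_surjective (Ideal.Quotient.mk (Ideal.ofList rs))
    Ideal.Quotient.mk_surjective (K := p.map (Ideal.Quotient.mk (Ideal.ofList rs)))
  rw [Ideal.comap_map_of_surjective _ Ideal.Quotient.mk_surjective,
    ← RingHom.ker_eq_comap_bot, Ideal.mk_ker, sup_eq_left.2 hle2] at h4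
  exact hpm (IsLocalRing.eq_maximalIdeal h4)

end final

/-- Let `R` be a commutative Noetherian regular local ring of Krull dimension `ℓ` with maximal
ideal `m`, and `M` a finitely generated `R`-module.  Then `M_p` is free for every prime
`p ≠ m` if and only if `Ext^p_R(Ext^q_R(M, R), R) = 0` for all `q > 0` and `p < ℓ`. -/
theorem free_outside_point_iff_ext_ext_vanish (R : Type) [CommRing R] [IsNoetherianRing R]
    [IsLocalRing R] (ℓ : ℕ)
    (hdim : ringKrullDim R = ℓ)
    (hreg : ∃ s : Finset R, s.card = ℓ ∧ Ideal.span (s : Set R) = IsLocalRing.maximalIdeal R)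
    (M : Type) [AddCommGroup M] [Module R M] [Module.Finite R M] :
    (∀ (p : Ideal R) (_ : p.IsPrime), p ≠ IsLocalRing.maximalIdeal R →
      Module.Free (Localization.AtPrime p) (LocalizedModule p.primeCompl M)) ↔
    (∀ q p : ℕ, 0 < q → p < ℓ →
      Subsingleton (ExtGrp R (ExtGrp R (ModuleCat.of R M) (ModuleCat.of R R) q)
        (ModuleCat.of R R) p)) := by
  obtain ⟨s, hcard, hspan⟩ := hreg
  obtain ⟨_, rs, hlen, hrs, hreg⟩ := reg_main ℓ R hdim
    ⟨fun i => ((s.equivFinOfCardEq hcard).symm i : R), by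
      rw [← hspan]
      congr 1
      ext x
      constructor
      · rintro ⟨i, rfl⟩
        exact ((s.equivFinOfCardEq hcard).symm i).2
      · intro hx
        exact ⟨s.equivFinOfCardEq hcard ⟨x, hx⟩, by simp⟩⟩
  constructor
  · intro hfree q p hq hpl
    let E := ExtGrp R (ModuleCat.of R M) (ModuleCat.of R R) q
    have hE : Module.Finite R E := finite_extGrp _ _ _
    refine (extGrpEquiv (ModuleCat.of R R) p E).toEquiv.subsingleton_congr.2 ?_
    refine ModuleCat.subsingleton_ext_of_exists_isRegular (IsLocalRing.maximalIdeal R) E ?_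
      (ModuleCat.of R R) ?_ rs ?_ hreg p (hlen ▸ hpl)
    · intro P hP
      by_contra hPm
      have hne : P.asIdeal ≠ IsLocalRing.maximalIdeal R := by
        intro h
        apply hPm
        rw [PrimeSpectrum.mem_zeroLocus, h]
      have := hfree P.asIdeal P.2 hne
      obtain ⟨k, φ, ψ, s, hs, hsf⟩ := factor_of_free P.asIdeal M
      apply hs
      refine Module.mem_support_iff_of_finite.1 hP ?_
      rw [Module.mem_annihilator]
      intro x
      apply (extGrpEquiv (ModuleCat.of R R) q (ModuleCat.of R M)).injective
      rw [map_smul, map_zero]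
      exact ext_kill_of_factor φ ψ s hsf _ q hq _
    · have : IsLocalRing.maximalIdeal R • (⊤ : Submodule R R) < ⊤ := by
        rw [smul_eq_mul, Ideal.mul_top]
        exact lt_top_iff_ne_top.2 Ideal.IsPrime.ne_top'
      exact this
    · intro r hr
      rw [← hrs]
      exact Ideal.subset_span hr
  · intro hvan p hp hpm
    obtain ⟨n, hn⟩ := fpd_all rs hrs hreg M
    have hkill : ∀ q > 0, ∃ s ∉ p,
        ∀ x : Abelian.Ext (ModuleCat.of R M) (ModuleCat.of R R) q, s • x = 0 := by
      intro q hq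
      have hE : Module.Finite R (ExtGrp R (ModuleCat.of R M) (ModuleCat.of R R) q) :=
        finite_extGrp _ _ _
      have h1 := not_le_of_vanish ℓ hdim (ExtGrp R (ModuleCat.of R M) (ModuleCat.of R R) q)
        (fun i hi => (extGrpEquiv (ModuleCat.of R R) i _).toEquiv.subsingleton_congr.1
          (hvan q i hq hi)) p hp hpm
      obtain ⟨s, hs, hsp⟩ := SetLike.not_le_iff_exists.1 h1
      refine ⟨s, hsp, fun x => ?_⟩
      apply (extGrpEquiv (ModuleCat.of R R) q (ModuleCat.of R M)).symm.injective
      rw [map_smul, map_zero]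
      exact Module.mem_annihilator.1 hs _
    obtain ⟨t, ht, htk⟩ := ext_kill_all p (ModuleCat.of R M) n hn hkill n 1 one_pos (by omega)
    obtain ⟨F, _, _, _, φ, ψ, hf⟩ := free_of_kill M t (fun N _ _ _ x => htk N x)
    exact free_of_factor p M F φ ψ t ht hf
end

section
/- Let K be a field of characteristic zero, S = K[x_1, …, x_ℓ], and let f ∈ S be a nonzero squarefree homogeneous polynomial of degree ≥ 1. Suppose that the localization D(f)_p is a free S_p-module for every prime ideal p of S other than the irrelevant maximal ideal (x_1, …, x_ℓ), and that pd_S Ω^1(f) ≤ 1. Then D(f) is a free S-module if and only if every associated prime of S/J_f has height exactly 2. -/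
open CategoryTheory MvPolynomial

/-- `pdLE R M n` means that the projective dimension of `M` over `R` is at most `n`,
expressed via the vanishing of `Ext^{n+1}(M, -)`. -/
def pdLE (R : Type) [CommRing R] (M : ModuleCat R) (n : ℕ) : Prop :=
  ∀ N : ModuleCat R, Subsingleton (ExtGrp R M N (n + 1))

/-- The module of logarithmic derivations
`D(f) = {θ ∈ S^ℓ : Σ_i θ_i ∂f/∂x_i ∈ (f)}`. -/
noncomputable def Dlog (K : Type) [CommRing K] (ℓ : ℕ) (f : MvPolynomial (Fin ℓ) K) :
    Submodule (MvPolynomial (Fin ℓ) K) (Fin ℓ → MvPolynomial (Fin ℓ) K) :=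
  Submodule.comap
    (∑ i : Fin ℓ, (LinearMap.toSpanSingleton (MvPolynomial (Fin ℓ) K)
      (MvPolynomial (Fin ℓ) K) (pderiv i f)).comp (LinearMap.proj i))
    (Ideal.span {f})

/-- The Jacobian ideal `J_f = (∂f/∂x_1, …, ∂f/∂x_ℓ)`. -/
noncomputable def jacobianIdeal (K : Type) [CommRing K] (ℓ : ℕ)
    (f : MvPolynomial (Fin ℓ) K) : Ideal (MvPolynomial (Fin ℓ) K) :=
  Ideal.span (Set.range fun i => pderiv i f)

theorem hasPD_of_pdLE (R : Type) [CommRing R] (M : ModuleCat R) (h : pdLE R M 1) :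
    HasProjectiveDimensionLT M 2 := by
  have key : ∀ (Y : ModuleCat R) (e : Abelian.Ext M Y 2), e = 0 := by
    intro Y e
    let P := projectiveResolution M
    obtain ⟨f, hf, rfl⟩ := P.extMk_surjective e 3 rfl
    have hz : Limits.IsZero ((P.complex.linearYonedaObj R Y).homology 2) := by
      have : Subsingleton (((Ext R (ModuleCat R) 2).obj (Opposite.op M)).obj Y) := h Y
      refine Limits.IsZero.of_iso ?_ (P.isoExt 2 Y).symm
      exact ModuleCat.isZero_of_subsingleton _
    rw [← HomologicalComplex.exactAt_iff_isZero_homology,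
      HomologicalComplex.exactAt_iff' _ 1 2 3 (by simp) (by simp),
      ShortComplex.moduleCat_exact_iff] at hz
    obtain ⟨g, hg⟩ := hz f hf
    rw [P.extMk_eq_zero_iff f 3 rfl hf 1 rfl]
    exact ⟨g, hg⟩
  apply hasProjectiveDimensionLT_of_enoughInjectives
  intro Y
  exact ⟨fun a b => by rw [key Y a, key Y b]⟩

theorem ker_projective (R : Type) [CommRing R] (M F : Type) [AddCommGroup M] [Module R M]
    [AddCommGroup F] [Module R F] [Module.Projective R F] (π : F →ₗ[R] M)
    (hπ : Function.Surjective π) (h : pdLE R (ModuleCat.of R M) 1) :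
    Module.Projective R (LinearMap.ker π) := by
  have h1 := hasPD_of_pdLE R _ h
  let S : ShortComplex (ModuleCat R) := ShortComplex.mk
    (ModuleCat.ofHom (LinearMap.ker π).subtype) (ModuleCat.ofHom π) (by ext x; exact x.2)
  have hS : S.ShortExact := ModuleCat.shortComplex_shortExact S
    (by
      intro x
      constructor
      · intro hx; exact ⟨⟨x, hx⟩, rfl⟩
      · rintro ⟨y, rfl⟩; exact y.2) (by exact Subtype.val_injective) hπ
  have h2 : Projective S.X₂ := (IsProjective.iff_projective (R := R) F).1 inferInstance
  have h3 := (hS.hasProjectiveDimensionLT_X₃_iff 0 h2).1 h1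
  rw [zero_add, ← projective_iff_hasProjectiveDimensionLT_one] at h3
  exact (IsProjective.iff_projective (R := R) (LinearMap.ker π)).2 h3

structure RegTriple {S : Type} [CommRing S] (T : Submonoid S) (a b c : S) : Prop where
  h1 : ∀ r, a * r = 0 → r = 0
  h2 : ∀ r, b * r ∈ Ideal.span {a} → ∃ s ∈ T, s * r ∈ Ideal.span {a}
  h3 : ∀ r, c * r ∈ Ideal.span {a, b} → ∃ s ∈ T, s * r ∈ Ideal.span {a, b}

section
variable {S : Type} [CommRing S] {T : Submonoid S} {a b c : S}

theorem RegTriple.k1 (h : RegTriple T a b c) (v w : S) (e : b * v = a * w) :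
    ∃ s ∈ T, ∃ g, s * v = a * g ∧ s * w = b * g := by
  obtain ⟨s, hs, hr⟩ := h.h2 v (by rw [e]; exact Ideal.mem_span_singleton.2 ⟨w, rfl⟩)
  obtain ⟨g, hg⟩ := Ideal.mem_span_singleton.1 hr
  refine ⟨s, hs, g, hg, ?_⟩
  have : a * (s * w - b * g) = 0 := by linear_combination -s * e + b * hg
  exact sub_eq_zero.1 (h.h1 _ this)

theorem RegTriple.k2 (h : RegTriple T a b c) (dab dac dbc : S)
    (e : a * dbc - b * dac + c * dab = 0) :
    ∃ s ∈ T, ∃ na nb nc, s * dab = a * nb - b * na ∧ s * dac = a * nc - c * na ∧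
      s * dbc = b * nc - c * nb := by
  obtain ⟨s1, hs1, hr⟩ := h.h3 dab (by
    rw [Ideal.mem_span_pair]; exact ⟨-dbc, dac, by linear_combination -e⟩)
  obtain ⟨nb, na', hn⟩ := Ideal.mem_span_pair.1 hr
  obtain ⟨s2, hs2, nc, e1, e2⟩ := h.k1 (s1 * dac - c * na') (s1 * dbc + c * nb)
    (by linear_combination - s1 * e - c * hn)
  refine ⟨s2 * s1, T.mul_mem hs2 hs1, -s2 * na', s2 * nb, nc, ?_, ?_, ?_⟩
  · linear_combination -s2 * hn
  · linear_combination e1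
  · linear_combination e2

theorem exists_common {ι : Type} [Finite ι] (P : ι → S → Prop)
    (hmul : ∀ i s t, P i s → P i (t * s)) (h : ∀ i, ∃ s ∈ T, P i s) :
    ∃ s ∈ T, ∀ i, P i s := by
  classical
  cases nonempty_fintype ι
  choose s hs hP using h
  refine ⟨∏ i, s i, T.prod_mem fun i _ => hs i, fun i => ?_⟩
  rw [← Finset.prod_erase_mul _ _ (Finset.mem_univ i)]
  exact hmul _ _ _ (hP i)

theorem RegTriple.k1M (h : RegTriple T a b c) {M : Type} [AddCommGroup M] [Module S M]
    [Module.Free S M] [Module.Finite S M] [Nontrivial S] (v w : M) (e : b • v = a • w) :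
    ∃ s ∈ T, ∃ g : M, s • v = a • g ∧ s • w = b • g := by
  let B := Module.Free.chooseBasis S M
  obtain ⟨s, hs, H⟩ := exists_common (T := T)
    (fun i s => ∃ g, s * B.equivFun v i = a * g ∧ s * B.equivFun w i = b * g)
    (by
      rintro i s t ⟨g, h1, h2⟩
      exact ⟨t * g, by linear_combination t * h1, by linear_combination t * h2⟩)
    (fun i => h.k1 _ _ (by simpa using congrFun (congrArg B.equivFun e) i))
  choose g h1 h2 using H
  refine ⟨s, hs, B.equivFun.symm g, ?_, ?_⟩
  · apply B.equivFun.injective; ext i; simpa only [map_smul, map_sub, LinearEquiv.apply_symm_apply, Pi.smul_apply, Pi.sub_apply,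
      smul_eq_mul] using h1 i
  · apply B.equivFun.injective; ext i; simpa only [map_smul, map_sub, LinearEquiv.apply_symm_apply, Pi.smul_apply, Pi.sub_apply,
      smul_eq_mul] using h2 i

theorem RegTriple.k2M (h : RegTriple T a b c) {M : Type} [AddCommGroup M] [Module S M]
    [Module.Free S M] [Module.Finite S M] [Nontrivial S] (dab dac dbc : M)
    (e : a • dbc - b • dac + c • dab = 0) :
    ∃ s ∈ T, ∃ na nb nc : M, s • dab = a • nb - b • na ∧ s • dac = a • nc - c • na ∧
      s • dbc = b • nc - c • nb := by
  let B := Module.Free.chooseBasis S M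
  obtain ⟨s, hs, H⟩ := exists_common (T := T)
    (fun i s => ∃ na nb nc, s * B.equivFun dab i = a * nb - b * na ∧
      s * B.equivFun dac i = a * nc - c * na ∧ s * B.equivFun dbc i = b * nc - c * nb)
    (by
      rintro i s t ⟨na, nb, nc, h1, h2, h3⟩
      exact ⟨t * na, t * nb, t * nc, by linear_combination t * h1, by linear_combination t * h2,
        by linear_combination t * h3⟩)
    (fun i => h.k2 _ _ _ (by simpa using congrFun (congrArg B.equivFun e) i))
  choose na nb nc h1 h2 h3 using H
  refine ⟨s, hs, B.equivFun.symm na, B.equivFun.symm nb, B.equivFun.symm nc, ?_, ?_, ?_⟩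
  · apply B.equivFun.injective; ext i; simpa only [map_smul, map_sub, LinearEquiv.apply_symm_apply, Pi.smul_apply, Pi.sub_apply,
      smul_eq_mul] using h1 i
  · apply B.equivFun.injective; ext i; simpa only [map_smul, map_sub, LinearEquiv.apply_symm_apply, Pi.smul_apply, Pi.sub_apply,
      smul_eq_mul] using h2 i
  · apply B.equivFun.injective; ext i; simpa only [map_smul, map_sub, LinearEquiv.apply_symm_apply, Pi.smul_apply, Pi.sub_apply,
      smul_eq_mul] using h3 i

/-- If the kernel of `u : G → S` is free then `S / range u` has depth at least one
along a regular triple. -/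
theorem RegTriple.lemmaA [IsDomain S] (h : RegTriple T a b c) {G : Type} [AddCommGroup G]
    [Module S G] [Module.Free S G] [Module.Finite S G] (u : G →ₗ[S] S)
    [Module.Free S (LinearMap.ker u)] [Module.Finite S (LinearMap.ker u)] (x : S)
    (ha : a * x ∈ LinearMap.range u) (hb : b * x ∈ LinearMap.range u)
    (hc : c * x ∈ LinearMap.range u) : ∃ s ∈ T, s * x ∈ LinearMap.range u := by
  obtain ⟨ga, ga'⟩ := ha
  obtain ⟨gb, gb'⟩ := hb
  obtain ⟨gc, gc'⟩ := hc
  let dab : LinearMap.ker u := ⟨a • gb - b • ga, by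
    simp [ga', gb']; ring⟩
  let dac : LinearMap.ker u := ⟨a • gc - c • ga, by
    simp [ga', gc']; ring⟩
  let dbc : LinearMap.ker u := ⟨b • gc - c • gb, by
    simp [gb', gc']; ring⟩
  obtain ⟨s, hs, na, nb, nc, e1, e2, e3⟩ := h.k2M dab dac dbc (by
    ext; simp [dab, dac, dbc]; module)
  have e1' : s • (a • gb - b • ga) = a • (nb : G) - b • (na : G) := congrArg Subtype.val e1
  obtain ⟨s2, hs2, g, f1, f2⟩ := h.k1M (s • ga - na : G) (s • gb - nb : G)
    (by linear_combination (norm := module) (-1 : S) • e1')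
  refine ⟨s2 * s, T.mul_mem hs2 hs, g, ?_⟩
  have a0 : a ≠ 0 := by
    rintro rfl
    exact one_ne_zero (h.h1 1 (by simp))
  apply mul_left_cancel₀ a0
  have := congrArg u f1
  have hna : u na = 0 := na.2
  simp [ga', hna] at this
  linear_combination -this

theorem RegTriple.lemmaB [IsDomain S] (h : RegTriple (⊥ : Submonoid S) a b c)
    {G : Type} [AddCommGroup G]
    [Module S G] [Module.Free S G] [Module.Finite S G] (u : G →ₗ[S] S)
    (hu : ∀ x, a * x ∈ LinearMap.range u → b * x ∈ LinearMap.range u →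
      c * x ∈ LinearMap.range u → x ∈ LinearMap.range u)
    {M0 M1 : Type} [AddCommGroup M0] [Module S M0] [Module.Free S M0] [Module.Finite S M0]
    [AddCommGroup M1] [Module S M1] (hM1 : ∀ x : M1, a • x = 0 → x = 0) (t : M0 →ₗ[S] M1)
    (e : LinearMap.ker t ≃ₗ[S] LinearMap.ker u) (φ : M1)
    (ha : a • φ ∈ LinearMap.range t) (hb : b • φ ∈ LinearMap.range t)
    (hc : c • φ ∈ LinearMap.range t) : φ ∈ LinearMap.range t := by
  obtain ⟨ga, ga'⟩ := ha
  obtain ⟨gb, gb'⟩ := hb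
  obtain ⟨gc, gc'⟩ := hc
  let dab : LinearMap.ker t := ⟨a • gb - b • ga, by
    rw [LinearMap.mem_ker, map_sub, map_smul, map_smul, ga', gb']; module⟩
  let dac : LinearMap.ker t := ⟨a • gc - c • ga, by
    rw [LinearMap.mem_ker, map_sub, map_smul, map_smul, ga', gc']; module⟩
  let dbc : LinearMap.ker t := ⟨b • gc - c • gb, by
    rw [LinearMap.mem_ker, map_sub, map_smul, map_smul, gb', gc']; module⟩
  have hd : a • dbc - b • dac + c • dab = 0 := by
    ext; simp [dab, dac, dbc]; module
  have hd' : a • (e dbc : G) - b • (e dac : G) + c • (e dab : G) = 0 := by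
    have := congrArg (fun z => (e z : G)) hd
    simpa using this
  obtain ⟨s, hs, na, nb, nc, e1, e2, e3⟩ := h.k2M _ _ _ hd'
  obtain rfl := Submonoid.mem_bot.1 hs
  simp only [one_smul] at e1 e2 e3
  have u1 := congrArg u e1
  have u2 := congrArg u e2
  rw [(e dab).2] at u1
  rw [(e dac).2] at u2
  simp only [map_sub, map_smul, smul_eq_mul] at u1 u2
  obtain ⟨s, hs, x, x1, x2⟩ := h.k1 (u na) (u nb) (by linear_combination u1)
  obtain rfl := Submonoid.mem_bot.1 hs
  simp only [one_mul] at x1 x2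
  have a0 : a ≠ 0 := by
    rintro rfl
    exact one_ne_zero (h.h1 1 (by simp))
  have x3 : u nc = c * x := by
    apply mul_left_cancel₀ a0
    linear_combination -u2 + c * x1
  obtain ⟨g, rfl⟩ := hu x ⟨na, x1⟩ ⟨nb, x2⟩ ⟨nc, x3⟩
  let ma : LinearMap.ker u := ⟨na - a • g, by simp [x1]⟩
  let mb : LinearMap.ker u := ⟨nb - b • g, by simp [x2]⟩
  have hm : dab = a • e.symm mb - b • e.symm ma := by
    apply e.injective
    simp only [map_sub, map_smul, LinearEquiv.apply_symm_apply]
    ext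
    simp only [ma, mb, Submodule.coe_sub, Submodule.coe_smul, e1]
    module
  have hm' : a • gb - b • ga = a • (e.symm mb : M0) - b • (e.symm ma : M0) :=
    congrArg Subtype.val hm
  obtain ⟨s, hs, y, y1, y2⟩ := h.k1M (ga - e.symm ma : M0) (gb - e.symm mb : M0)
    (by linear_combination (norm := module) (-1 : S) • hm')
  obtain rfl := Submonoid.mem_bot.1 hs
  refine ⟨y, ?_⟩
  have := congrArg t y1
  have h0 : t (e.symm ma) = 0 := (e.symm ma).2
  simp only [one_smul, map_sub, h0, map_smul, ga', sub_zero] at this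
  rw [← sub_eq_zero]
  apply hM1
  rw [smul_sub, this, sub_self]
end

section RegularTriples

theorem pseudo_zero {A : Type} [CommRing A] (P : Polynomial A) (n : ℕ) (hn : P.natDegree ≤ n)
    (m : ℕ) (r : Polynomial A) (hm : r.natDegree ≤ m) (h : P * r = 0) :
    ∃ k, Polynomial.C (P.coeff n ^ k) * r = 0 := by
  induction m generalizing r with
  | zero =>
    have h1 := Polynomial.coeff_mul_add_eq_of_natDegree_le hn hm
    rw [h, Polynomial.coeff_zero] at h1
    refine ⟨1, ?_⟩
    rw [Polynomial.eq_C_of_natDegree_le_zero hm, ← Polynomial.C_mul, pow_one, ← h1,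
      Polynomial.C_0]
  | succ m ih =>
    have h1 := Polynomial.coeff_mul_add_eq_of_natDegree_le hn hm
    rw [h, Polynomial.coeff_zero] at h1
    obtain ⟨k, hk⟩ := ih (Polynomial.C (P.coeff n) * r) (by
      rw [Polynomial.natDegree_le_iff_coeff_eq_zero]
      intro N hN
      rw [Polynomial.coeff_C_mul]
      rcases eq_or_lt_of_le (Nat.succ_le_of_lt hN) with h2 | h2
      · rw [← h2]; exact h1.symm
      · rw [Polynomial.coeff_eq_zero_of_natDegree_lt (lt_of_le_of_lt hm h2), mul_zero])
      (by rw [mul_left_comm, h, mul_zero])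
    exact ⟨k + 1, by rw [pow_succ, Polynomial.C_mul, mul_assoc]; exact hk⟩

theorem pseudo_ideal {A : Type} [CommRing A] (I : Ideal A) (P r : Polynomial A)
    (h : P * r ∈ I.map Polynomial.C) :
    ∃ k, Polynomial.C (P.leadingCoeff ^ k) * r ∈ I.map Polynomial.C := by
  have key : ∀ x : Polynomial A, x ∈ I.map Polynomial.C ↔
      x.map (Ideal.Quotient.mk I) = 0 := by
    intro x
    rw [Ideal.mem_map_C_iff, Polynomial.ext_iff]
    simp [Ideal.Quotient.eq_zero_iff_mem]
  rw [key, Polynomial.map_mul] at h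
  obtain ⟨k, hk⟩ := pseudo_zero _ P.natDegree Polynomial.natDegree_map_le _ _ le_rfl h
  refine ⟨k, ?_⟩
  rw [key, Polynomial.map_mul]
  simpa [Polynomial.coeff_map] using hk

variable {K σ : Type} [Field K]

/-- the polynomials not involving the variable `y` -/
noncomputable def avoidHom (K : Type) [Field K] {σ : Type} (y : σ) :
    MvPolynomial {i // i ≠ y} K →+* MvPolynomial σ K :=
  (rename (Subtype.val : {i // i ≠ y} → σ) : _ →ₐ[K] _).toRingHom

open Classical in
/-- separating the variable `y` -/
noncomputable def sepEquiv (K : Type) [Field K] {σ : Type} (y : σ) :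
    MvPolynomial σ K ≃ₐ[K] Polynomial (MvPolynomial {i // i ≠ y} K) :=
  (renameEquiv K (Equiv.optionSubtypeNe y).symm).trans (optionEquivLeft K {i // i ≠ y})

theorem sepEquiv_X (y : σ) : sepEquiv K y (X y) = Polynomial.X := by
  classical
  simp [sepEquiv]

theorem sepEquiv_avoid (y : σ) (p : MvPolynomial {i // i ≠ y} K) :
    sepEquiv K y (avoidHom K y p) = Polynomial.C p := by
  classical
  have : ((sepEquiv K y).toRingEquiv.toRingHom.comp (avoidHom K y)) = Polynomial.C := by
    apply MvPolynomial.ringHom_ext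
    · intro r
      simp [avoidHom]
      rw [← MvPolynomial.algebraMap_eq, AlgEquiv.commutes]
      rfl
    · intro i
      simp [avoidHom, sepEquiv, Equiv.optionSubtypeNe_symm_of_ne i.2, i.2]
  exact congrArg (fun f : _ →+* _ => f p) this

theorem sepEquiv_eval (y : σ) (P : Polynomial (MvPolynomial {i // i ≠ y} K)) :
    sepEquiv K y (P.eval₂ (avoidHom K y) (X y)) = P := by
  have := Polynomial.hom_eval₂ P (avoidHom K y) (sepEquiv K y).toRingEquiv.toRingHom (X y)
  have h2 : ((sepEquiv K y).toRingEquiv.toRingHom.comp (avoidHom K y)) = Polynomial.C := by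
    exact RingHom.ext fun p => sepEquiv_avoid y p
  rw [h2] at this
  refine Eq.trans this ?_
  have h3 : (sepEquiv K y).toRingEquiv.toRingHom (X y) = Polynomial.X := sepEquiv_X y
  rw [h3, Polynomial.eval₂_C_X]

theorem pseudo_mv (y : σ) (I : Ideal (MvPolynomial {i // i ≠ y} K))
    (P : Polynomial (MvPolynomial {i // i ≠ y} K)) (r : MvPolynomial σ K)
    (h : P.eval₂ (avoidHom K y) (X y) * r ∈ I.map (avoidHom K y)) :
    ∃ k, avoidHom K y (P.leadingCoeff) ^ k * r ∈ I.map (avoidHom K y) := by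
  have h2 : ((sepEquiv K y).toRingEquiv.toRingHom.comp (avoidHom K y)) = Polynomial.C := by
    exact RingHom.ext fun p => sepEquiv_avoid y p
  have key : ∀ x, x ∈ I.map (avoidHom K y) ↔ sepEquiv K y x ∈ I.map Polynomial.C := by
    intro x
    rw [← h2, ← Ideal.map_map]
    constructor
    · intro hx
      exact Ideal.mem_map_of_mem (sepEquiv K y).toRingEquiv.toRingHom hx
    · intro hx
      obtain ⟨z, hz, e⟩ := (Ideal.mem_map_iff_of_surjective _
        (sepEquiv K y).toRingEquiv.surjective).1 hx
      rwa [← (sepEquiv K y).injective e]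
  rw [key, map_mul, sepEquiv_eval] at h
  obtain ⟨k, hk⟩ := pseudo_ideal I P _ h
  refine ⟨k, ?_⟩
  rw [key, map_mul, map_pow, sepEquiv_avoid, ← Polynomial.C_pow]
  exact hk

/-- three univariate-type polynomials in different variables form a regular triple,
up to leading coefficients -/
theorem regTriple_of (B : Set σ) (y1 y2 y3 : σ) (h1 : y1 ∉ B) (h2 : y2 ∉ B) (h3 : y3 ∉ B)
    (h12 : y1 ≠ y2) (h13 : y1 ≠ y3) (h23 : y2 ≠ y3) (T : Submonoid (MvPolynomial σ K))
    (P1 P2 P3 : Polynomial (MvPolynomial B K)) (hP1 : P1 ≠ 0)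
    (hT2 : rename Subtype.val P2.leadingCoeff ∈ T) (hT3 : rename Subtype.val P3.leadingCoeff ∈ T) :
    RegTriple T (P1.eval₂ (rename Subtype.val : _ →ₐ[K] MvPolynomial σ K).toRingHom (X y1))
      (P2.eval₂ (rename Subtype.val : _ →ₐ[K] MvPolynomial σ K).toRingHom (X y2))
      (P3.eval₂ (rename Subtype.val : _ →ₐ[K] MvPolynomial σ K).toRingHom (X y3)) := by
  -- inclusion of `K[B]`
  let inc : ∀ y, y ∉ B → (MvPolynomial B K →+* MvPolynomial {i // i ≠ y} K) := fun y hy =>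
    (rename (fun i : B => (⟨i, fun e => hy (e ▸ i.2)⟩ : {i // i ≠ y})) : _ →ₐ[K] _).toRingHom
  have inc_inj : ∀ y hy, Function.Injective (inc y hy) := by
    intro y hy
    apply rename_injective
    intro i j e
    ext
    exact congrArg (fun z : {i // i ≠ y} => (z : σ)) e
  have inc_comp : ∀ y hy, (avoidHom K y).comp (inc y hy) =
      (rename Subtype.val : _ →ₐ[K] MvPolynomial σ K).toRingHom := by
    intro y hy
    apply MvPolynomial.ringHom_ext
    · intro r; simp [avoidHom, inc]
    · intro i; simp [avoidHom, inc]
  have ev : ∀ y hy (P : Polynomial (MvPolynomial B K)),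
      P.eval₂ (rename Subtype.val : _ →ₐ[K] MvPolynomial σ K).toRingHom (X y) =
      (P.map (inc y hy)).eval₂ (avoidHom K y) (X y) := by
    intro y hy P
    rw [Polynomial.eval₂_map, inc_comp]
  have lc : ∀ y hy (P : Polynomial (MvPolynomial B K)),
      avoidHom K y (P.map (inc y hy)).leadingCoeff = rename Subtype.val P.leadingCoeff := by
    intro y hy P
    rw [Polynomial.leadingCoeff_map_of_injective (inc_inj y hy)]
    exact congrArg (fun f : _ →+* _ => f P.leadingCoeff) (inc_comp y hy)
  have av : ∀ y y' (_ : y' ≠ y) (hy : y ∉ B) (P : Polynomial (MvPolynomial B K)),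
      ∃ z, avoidHom K y z =
        P.eval₂ (rename Subtype.val : _ →ₐ[K] MvPolynomial σ K).toRingHom (X y') := by
    intro y y' hyy hy P
    refine ⟨P.eval₂ (inc y hy) (X ⟨y', hyy⟩), ?_⟩
    rw [Polynomial.hom_eval₂, inc_comp]
    congr 1
    simp [avoidHom]
  refine ⟨?_, ?_, ?_⟩
  · intro r hr
    refine (mul_eq_zero.1 hr).resolve_left ?_
    intro h0
    rw [ev y1 h1] at h0
    have := congrArg (sepEquiv K y1) h0
    rw [sepEquiv_eval, map_zero] at this
    exact hP1 (Polynomial.map_injective _ (inc_inj y1 h1) (by simpa using this))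
  · intro r hr
    obtain ⟨z, hz⟩ := av y2 y1 h12 h2 P1
    have hI : Ideal.span {Polynomial.eval₂ (rename Subtype.val :
        _ →ₐ[K] MvPolynomial σ K).toRingHom (X y1) P1} =
        (Ideal.span {z}).map (avoidHom K y2) := by
      rw [Ideal.map_span, Set.image_singleton, hz]
    rw [hI] at hr ⊢
    rw [ev y2 h2] at hr
    obtain ⟨k, hk⟩ := pseudo_mv y2 _ _ _ hr
    rw [lc] at hk
    exact ⟨_, T.pow_mem hT2 k, hk⟩
  · intro r hr
    obtain ⟨z, hz⟩ := av y3 y1 h13 h3 P1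
    obtain ⟨z', hz'⟩ := av y3 y2 h23 h3 P2
    have hI : Ideal.span {Polynomial.eval₂ (rename Subtype.val :
        _ →ₐ[K] MvPolynomial σ K).toRingHom (X y1) P1, Polynomial.eval₂ (rename Subtype.val :
        _ →ₐ[K] MvPolynomial σ K).toRingHom (X y2) P2} =
        (Ideal.span {z, z'}).map (avoidHom K y3) := by
      rw [Ideal.map_span, Set.image_pair, hz, hz']
    rw [hI] at hr ⊢
    rw [ev y3 h3] at hr
    obtain ⟨k, hk⟩ := pseudo_mv y3 _ _ _ hr
    rw [lc] at hk
    exact ⟨_, T.pow_mem hT3 k, hk⟩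

theorem regTriple_X (y1 y2 y3 : σ) 
    (h12 : y1 ≠ y2) (h13 : y1 ≠ y3) (h23 : y2 ≠ y3) :
    RegTriple (⊥ : Submonoid (MvPolynomial σ K)) (X y1) (X y2) (X y3) := by
  have := regTriple_of (K := K) (∅ : Set σ) y1 y2 y3 (by simp) (by simp) (by simp) h12 h13 h23
    ⊥ Polynomial.X Polynomial.X Polynomial.X Polynomial.X_ne_zero (by simp) (by simp)
  simpa using this

open Classical in
theorem exists_regTriple [Finite σ] (q : Ideal (MvPolynomial σ K)) [hq : q.IsPrime]
    (hh : 2 < q.height) :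
    ∃ a ∈ q, ∃ b ∈ q, ∃ c ∈ q, RegTriple q.primeCompl a b c := by
  let good : Set σ → Prop := fun B => ∀ p : MvPolynomial B K,
    rename (Subtype.val : B → σ) p ∈ q → p = 0
  have h0 : good ∅ := by
    intro p hp
    obtain ⟨r, rfl⟩ := MvPolynomial.C_surjective (∅ : Set σ) p
    by_contra hr
    have hr0 : r ≠ 0 := by rintro rfl; simp at hr
    rw [rename_C] at hp
    exact hq.ne_top (Ideal.eq_top_of_isUnit_mem _ hp ((IsUnit.mk0 r hr0).map C))
  obtain ⟨B, -, hB⟩ := Set.Finite.exists_le_maximal (Set.toFinite {B | good B}) h0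
  have hBg : good B := hB.prop
  let ι : MvPolynomial B K →+* MvPolynomial σ K :=
    (rename Subtype.val : _ →ₐ[K] MvPolynomial σ K).toRingHom
  have hex : ∀ y : σ, y ∉ B → ∃ P : Polynomial (MvPolynomial B K), P ≠ 0 ∧
      P.eval₂ ι (X y) ∈ q := by
    intro y hy
    have hn : ¬ good (insert y B) := fun h =>
      hy (hB.le_of_ge h (Set.subset_insert y B) (Set.mem_insert y B))
    simp only [good] at hn
    push Not at hn
    obtain ⟨p, hp, hp0⟩ := hn
    let E := (renameEquiv K (Set.subtypeInsertEquivOption hy)).trans (optionEquivLeft K B)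
    refine ⟨E p, by simpa using hp0, ?_⟩
    have : ((Polynomial.eval₂RingHom ι (X y)).comp E.toRingEquiv.toRingHom) =
        (rename Subtype.val : _ →ₐ[K] MvPolynomial σ K).toRingHom := by
      apply MvPolynomial.ringHom_ext
      · intro r
        simp [E, ι]
      · rintro ⟨i, hi⟩
        by_cases hiy : i = y
        · subst hiy
          simp [E, ι, Set.subtypeInsertEquivOption]
        · have : i ∈ B := hi.resolve_left hiy
          simp [E, ι, Set.subtypeInsertEquivOption, hiy]
    have h2 := congrArg (fun f : _ →+* _ => f p) this
    have h3 : Polynomial.eval₂ ι (X y) (E p) = rename Subtype.val p := h2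
    rw [h3]; exact hp
  choose! P hP0 hPq using hex
  -- the height bound
  have hmin : q ∈ (Ideal.span ((fun y => (P y).eval₂ ι (X y)) '' Bᶜ)).minimalPrimes := by
    refine ⟨⟨hq, ?_⟩, ?_⟩
    · rw [Ideal.span_le]; rintro _ ⟨y, hy, rfl⟩; exact hPq y hy
    · rintro p ⟨hp, hle⟩ hpq x hx
      by_contra hxp
      letI : Algebra (MvPolynomial B K) (MvPolynomial σ K ⧸ p) :=
        ((Ideal.Quotient.mk p).comp ι).toAlgebra
      have halgX : ∀ i, IsAlgebraic (MvPolynomial B K) (Ideal.Quotient.mk p (X i)) := by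
        intro i
        by_cases hi : i ∈ B
        · have : Ideal.Quotient.mk p (X i) =
              algebraMap (MvPolynomial B K) (MvPolynomial σ K ⧸ p) (X ⟨i, hi⟩) := by
            change _ = Ideal.Quotient.mk p (ι (X ⟨i, hi⟩))
            simp [ι]
          rw [this]
          exact isAlgebraic_algebraMap _
        · refine ⟨P i, hP0 i hi, ?_⟩
          have h1 : Ideal.Quotient.mk p ((P i).eval₂ ι (X i)) = 0 :=
            Ideal.Quotient.eq_zero_iff_mem.2 (hle (Ideal.subset_span ⟨i, hi, rfl⟩))
          rw [Polynomial.hom_eval₂] at h1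
          exact h1
      have halg : ∀ z, IsAlgebraic (MvPolynomial B K) (Ideal.Quotient.mk p z) := by
        intro z
        induction z using MvPolynomial.induction_on with
        | C r =>
          have : Ideal.Quotient.mk p (C r) =
              algebraMap (MvPolynomial B K) (MvPolynomial σ K ⧸ p) (C r) := by
            change _ = Ideal.Quotient.mk p (ι (C r))
            simp [ι]
          rw [this]
          exact isAlgebraic_algebraMap _
        | add a b ha hb => rw [map_add]; exact ha.add hb
        | mul_X a i ha => rw [map_mul]; exact ha.mul (halgX i)
      obtain ⟨r, hr0, hr⟩ := (halg x).exists_nonzero_dvd (mem_nonZeroDivisors_of_ne_zero (by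
        rwa [Ne, Ideal.Quotient.eq_zero_iff_mem]))
      obtain ⟨w, hw⟩ := hr
      obtain ⟨w, rfl⟩ := Ideal.Quotient.mk_surjective w
      change Ideal.Quotient.mk p (ι r) = _ at hw
      rw [← map_mul, Ideal.Quotient.eq] at hw
      apply hr0
      apply hBg
      have := q.add_mem (hpq hw) (q.mul_mem_right w hx)
      have h' : ι r ∈ q := by simpa using this
      exact h'
  have hcard := Ideal.height_le_card_of_mem_minimalPrimes_span (Set.toFinite _) hmin
  have h3 : 2 < (Bᶜ : Set σ).ncard := by
    have h4 := lt_of_lt_of_le hh hcard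
    have h5 : 2 < ((fun y => (P y).eval₂ ι (X y)) '' Bᶜ).ncard := by
      exact_mod_cast h4
    exact lt_of_lt_of_le h5 (Set.ncard_image_le (Set.toFinite _))
  rw [Set.two_lt_ncard_iff] at h3
  obtain ⟨y1, y2, y3, m1, m2, m3, h12, h13, h23⟩ := h3
  have hlc : ∀ y ∉ B, rename Subtype.val (P y).leadingCoeff ∈ q.primeCompl := by
    intro y hy hmem
    exact hP0 y hy (Polynomial.leadingCoeff_eq_zero.1 (hBg _ hmem))
  exact ⟨_, hPq y1 m1, _, hPq y2 m2, _, hPq y3 m3,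
    regTriple_of B y1 y2 y3 m1 m2 m3 h12 h13 h23 _ (P y1) (P y2) (P y3) (hP0 y1 m1)
      (hlc y2 m2) (hlc y3 m3)⟩

end RegularTriples

section LogCommon
variable {K : Type} [Field K] {ℓ : ℕ} {f : MvPolynomial (Fin ℓ) K}

theorem mem_Dlog (θ : Fin ℓ → MvPolynomial (Fin ℓ) K) :
    θ ∈ Dlog K ℓ f ↔ f ∣ ∑ i, θ i * pderiv i f := by
  rw [Dlog, Submodule.mem_comap, Ideal.mem_span_singleton]
  simp

/-- the map `(θ, h) ↦ θ(f) - h f` -/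
noncomputable def uMap (f : MvPolynomial (Fin ℓ) K) :
    ((Fin ℓ → MvPolynomial (Fin ℓ) K) × MvPolynomial (Fin ℓ) K) →ₗ[MvPolynomial (Fin ℓ) K]
      MvPolynomial (Fin ℓ) K where
  toFun p := ∑ i, p.1 i * pderiv i f - p.2 * f
  map_add' p q := by
    simp only [Prod.fst_add, Prod.snd_add, Pi.add_apply, add_mul, Finset.sum_add_distrib]
    ring
  map_smul' c p := by
    simp only [Prod.smul_fst, Prod.smul_snd, Pi.smul_apply, smul_eq_mul, RingHom.id_apply,
      mul_sub, Finset.mul_sum, mul_assoc]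

theorem uMap_apply (p : (Fin ℓ → MvPolynomial (Fin ℓ) K) × MvPolynomial (Fin ℓ) K) :
    uMap f p = ∑ i, p.1 i * pderiv i f - p.2 * f := rfl

theorem self_mem_jacobian [CharZero K] {d : ℕ} (hd : 1 ≤ d) (hf : f.IsHomogeneous d) :
    f ∈ jacobianIdeal K ℓ f := by
  have h := hf.sum_X_mul_pderiv
  have h2 : (d • f) ∈ jacobianIdeal K ℓ f := by
    rw [← h]
    exact Ideal.sum_mem _ fun i _ => Ideal.mul_mem_left _ _ (Ideal.subset_span ⟨i, rfl⟩)
  have h3 : f = C ((d : K)⁻¹) * (d • f) := by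
    have hd' : (d : K) ≠ 0 := by exact_mod_cast (by omega : d ≠ 0)
    rw [nsmul_eq_mul, ← mul_assoc, ← map_natCast (C : K →+* MvPolynomial (Fin ℓ) K), ← C_mul,
      inv_mul_cancel₀ hd', C_1, one_mul]
  have h4 := Ideal.mul_mem_left _ (C ((d : K)⁻¹)) h2
  rwa [← h3] at h4

theorem range_uMap (hJ : f ∈ jacobianIdeal K ℓ f) (x : MvPolynomial (Fin ℓ) K) :
    x ∈ LinearMap.range (uMap f) ↔ x ∈ jacobianIdeal K ℓ f := by
  constructor
  · rintro ⟨p, rfl⟩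
    rw [uMap_apply]
    refine Ideal.sub_mem _ (Ideal.sum_mem _ fun i _ =>
      Ideal.mul_mem_left _ _ (Ideal.subset_span ⟨i, rfl⟩)) (Ideal.mul_mem_left _ _ hJ)
  · intro h
    obtain ⟨c, hc⟩ := (Ideal.mem_span_range_iff_exists_fun).1 h
    exact ⟨(c, 0), by rw [uMap_apply]; simpa using hc⟩

theorem kerU_mem (p : LinearMap.ker (uMap f)) : p.1.1 ∈ Dlog K ℓ f := by
  rw [mem_Dlog]
  have := p.2
  rw [LinearMap.mem_ker, uMap_apply, sub_eq_zero] at this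
  exact ⟨p.1.2, by rw [this, mul_comm]⟩

/-- `D(f)` is the kernel of `uMap` -/
noncomputable def kerUEquiv (hf0 : f ≠ 0) :
    LinearMap.ker (uMap f) ≃ₗ[MvPolynomial (Fin ℓ) K] Dlog K ℓ f :=
  LinearEquiv.ofBijective
    { toFun := fun p => ⟨p.1.1, kerU_mem p⟩
      map_add' := fun _ _ => rfl
      map_smul' := fun _ _ => rfl }
    ⟨by
      rintro ⟨⟨θ, h⟩, hp⟩ ⟨⟨θ', h'⟩, hp'⟩ e
      have e1 : θ = θ' := congrArg Subtype.val e
      subst e1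
      rw [LinearMap.mem_ker, uMap_apply, sub_eq_zero] at hp hp'
      have : h = h' := mul_right_cancel₀ hf0 (hp.symm.trans hp')
      subst this
      rfl, by
      rintro ⟨θ, hθ⟩
      obtain ⟨h, hh⟩ := (mem_Dlog θ).1 hθ
      refine ⟨⟨(θ, h), ?_⟩, rfl⟩
      rw [LinearMap.mem_ker, uMap_apply, sub_eq_zero, mul_comm h f]
      exact hh⟩

theorem not_dvd_all_pderiv [CharZero K] (hsq : Squarefree f) (g : MvPolynomial (Fin ℓ) K)
    (hg : Prime g) (hgf : g ∣ f) : ∃ i, ¬ g ∣ pderiv i f := by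
  by_contra! hall
  obtain ⟨h, rfl⟩ := hgf
  have h1 : ¬ g ∣ h := by
    intro ⟨k, hk⟩
    exact hg.not_isUnit (hsq g ⟨k, by rw [hk]; ring⟩)
  have h2 : ∀ i, pderiv i g = 0 := by
    intro i
    have := hall i
    rw [Derivation.leibniz, smul_eq_mul, smul_eq_mul] at this
    have h3 : g ∣ h * pderiv i g := (dvd_add_right (Dvd.intro _ rfl)).1 this
    have h4 := (hg.dvd_or_dvd h3).resolve_left h1
    by_contra h0
    obtain ⟨w, hw⟩ := h4
    have hw0 : w ≠ 0 := by rintro rfl; exact h0 (by simpa using hw)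
    have hd := congrArg totalDegree hw
    rw [totalDegree_mul_of_isDomain hg.ne_zero hw0] at hd
    have hlt : (pderiv i g).totalDegree < g.totalDegree := by
      obtain ⟨m, hm, e⟩ := Finset.exists_mem_eq_sup (pderiv i g).support
        (support_nonempty.2 h0) (fun s => s.sum fun _ e => e)
      change (pderiv i g).totalDegree = _ at e
      rw [mem_support_iff, coeff_pderiv] at hm
      have h5 := le_totalDegree (mem_support_iff.2 (left_ne_zero_of_mul hm))
      rw [Finsupp.sum_add_index' (by simp) (by simp), Finsupp.sum_single_index rfl] at h5
      rw [e]
      omega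
    omega
  -- `g` is constant
  have h3 : g = C (coeff 0 g) := by
    ext m
    rw [coeff_C]
    split_ifs with hm
    · rw [hm]
    · obtain ⟨i, hi⟩ : ∃ i, m i ≠ 0 := by
        by_contra! hc
        exact hm (by ext i; simp [hc i])
      have := congrArg (coeff (m - Finsupp.single i 1)) (h2 i)
      have hle : Finsupp.single i 1 ≤ m := by
        rw [Finsupp.single_le_iff]; omega
      rw [coeff_pderiv, tsub_add_cancel_of_le hle, coeff_zero] at this
      refine (mul_eq_zero.1 this).resolve_right ?_
      exact Nat.cast_add_one_ne_zero _
  apply hg.not_isUnit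
  rw [h3]
  refine (isUnit_iff_ne_zero.2 ?_).map C
  intro h0
  rw [h0, C_0] at h3
  exact hg.ne_zero h3

theorem height_ge_two [CharZero K] (hf0 : f ≠ 0) (hsq : Squarefree f)
    (hJ : f ∈ jacobianIdeal K ℓ f) (q : Ideal (MvPolynomial (Fin ℓ) K)) (hq : q.IsPrime)
    (hle : jacobianIdeal K ℓ f ≤ q) : 2 ≤ Order.height (⟨q, hq⟩ : PrimeSpectrum _) := by
  have hfq := hle hJ
  obtain ⟨g, hg, hgf, hgq⟩ : ∃ g, Prime g ∧ g ∣ f ∧ g ∈ q := by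
    have hu := UniqueFactorizationMonoid.factors_prod hf0
    have h1 : (UniqueFactorizationMonoid.factors f).prod ∈ q :=
      (Ideal.mem_iff_of_associated hu).2 hfq
    obtain ⟨g, hg, hgq⟩ := (hq.multiset_prod_mem_iff_exists_mem _).1 h1
    exact ⟨g, UniqueFactorizationMonoid.prime_of_factor g hg,
      UniqueFactorizationMonoid.dvd_of_mem_factors hg, hgq⟩
  obtain ⟨i, hi⟩ := not_dvd_all_pderiv hsq g hg hgf
  have hgp : (Ideal.span {g}).IsPrime := (Ideal.span_singleton_prime hg.ne_zero).2 hg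
  let p0 : PrimeSpectrum (MvPolynomial (Fin ℓ) K) := ⟨⊥, Ideal.isPrime_bot⟩
  let p1 : PrimeSpectrum (MvPolynomial (Fin ℓ) K) := ⟨Ideal.span {g}, hgp⟩
  let p2 : PrimeSpectrum (MvPolynomial (Fin ℓ) K) := ⟨q, hq⟩
  have h01 : p0 < p1 := by
    refine lt_of_le_of_ne (bot_le : (⊥ : Ideal _) ≤ _) fun e => ?_
    have e' : (⊥ : Ideal _) = Ideal.span {g} := congrArg PrimeSpectrum.asIdeal e
    exact hg.ne_zero (Ideal.span_singleton_eq_bot.1 e'.symm)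
  have h12 : p1 < p2 := by
    refine lt_of_le_of_ne ((Ideal.span_singleton_le_iff_mem _).2 hgq : Ideal.span {g} ≤ q)
      fun e => ?_
    have e' : Ideal.span {g} = q := congrArg PrimeSpectrum.asIdeal e
    apply hi
    rw [← Ideal.mem_span_singleton, e']
    exact hle (Ideal.subset_span ⟨i, rfl⟩)
  have a1 := Order.height_add_one_le h01
  have a2 := Order.height_add_one_le h12
  calc (2 : ℕ∞) = 0 + 1 + 1 := by norm_num
    _ ≤ Order.height p0 + 1 + 1 := by gcongr; exact zero_le
    _ ≤ Order.height p1 + 1 := by gcongr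
    _ ≤ _ := a2

theorem pure_of_free [CharZero K] (hf0 : f ≠ 0) (hsq : Squarefree f)
    (hJ : f ∈ jacobianIdeal K ℓ f)
    (hfree : Module.Free (MvPolynomial (Fin ℓ) K) (Dlog K ℓ f))
    (q : Ideal (MvPolynomial (Fin ℓ) K)) (hq : q.IsPrime)
    (hass : q ∈ associatedPrimes (MvPolynomial (Fin ℓ) K)
        (MvPolynomial (Fin ℓ) K ⧸ jacobianIdeal K ℓ f)) :
    Order.height (⟨q, hq⟩ : PrimeSpectrum (MvPolynomial (Fin ℓ) K)) = 2 := by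
  obtain ⟨-, x, hx⟩ := (isAssociatedPrime_iff).1 hass
  obtain ⟨x, rfl⟩ := Ideal.Quotient.mk_surjective x
  have hmem : ∀ r, r ∈ q ↔ r * x ∈ jacobianIdeal K ℓ f := by
    intro r
    rw [hx, Submodule.mem_colon_singleton, Submodule.mem_bot]
    change Ideal.Quotient.mk (jacobianIdeal K ℓ f) (r * x) = 0 ↔ _
    rw [Ideal.Quotient.eq_zero_iff_mem]
  refine le_antisymm ?_ (height_ge_two hf0 hsq hJ q hq fun r hr =>
    (hmem r).2 (Ideal.mul_mem_right _ _ hr))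
  by_contra! hlt
  have hlt' : 2 < q.height := by
    rwa [PrimeSpectrum.height_eq_orderHeight ⟨q, hq⟩]
  obtain ⟨a, ha, b, hb, c, hc, H⟩ := exists_regTriple q hlt'
  have : Module.Free (MvPolynomial (Fin ℓ) K) (LinearMap.ker (uMap f)) :=
    Module.Free.of_equiv (kerUEquiv hf0).symm
  obtain ⟨s, hs, hsx⟩ := H.lemmaA (uMap f) x ((range_uMap hJ _).2 ((hmem a).1 ha))
    ((range_uMap hJ _).2 ((hmem b).1 hb)) ((range_uMap hJ _).2 ((hmem c).1 hc))
  exact hs ((hmem s).2 ((range_uMap hJ _).1 hsx))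
end LogCommon

section Homological
variable {S : Type} [CommRing S]

theorem proj_of_extend {F0 M : Type} [AddCommGroup F0] [Module S F0] [AddCommGroup M]
    [Module S M] [Module.Projective S F0] (π : F0 →ₗ[S] M) (hπ : Function.Surjective π)
    [Module.Projective S (LinearMap.ker π)] [Module.Finite S (LinearMap.ker π)]
    (h : Function.Surjective (LinearMap.ker π).dualRestrict) : Module.Projective S M := by
  obtain ⟨k, p, i, -, -, hpi⟩ := Module.Finite.exists_comp_eq_id_of_projective S (LinearMap.ker π)
  choose ψ hψ using fun j : Fin k => h ((LinearMap.proj j).comp i)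
  let r : F0 →ₗ[S] LinearMap.ker π := p.comp (LinearMap.pi ψ)
  have hr : ∀ x : LinearMap.ker π, r x = x := by
    intro x
    have h1 : (LinearMap.pi ψ) (x : F0) = i x := by
      ext j
      exact congrArg (fun g : Module.Dual S (LinearMap.ker π) => g x) (hψ j)
    change p _ = _
    rw [h1]
    exact congrArg (fun g : _ →ₗ[S] _ => g x) hpi
  let σ0 : F0 ⧸ LinearMap.ker π →ₗ[S] F0 :=
    (LinearMap.ker π).liftQ (LinearMap.id - (LinearMap.ker π).subtype.comp r) (by
      intro x hx
      rw [LinearMap.mem_ker]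
      simp [hr ⟨x, hx⟩])
  refine Module.Projective.of_split
    (σ0.comp (π.quotKerEquivOfSurjective hπ).symm.toLinearMap) π ?_
  ext m
  obtain ⟨x, rfl⟩ := hπ m
  have h2 : (π.quotKerEquivOfSurjective hπ).symm (π x) = Submodule.Quotient.mk x := by
    rw [LinearEquiv.symm_apply_eq]
    rfl
  simp [h2, σ0]

theorem extend_up {F0 M G : Type} [AddCommGroup F0] [Module S F0] [AddCommGroup M]
    [Module S M] [AddCommGroup G] [Module S G] [Module.Projective S G]
    (π : F0 →ₗ[S] M) (hπ : Function.Surjective π)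
    (α : M →ₗ[S] G) (β : G →ₗ[S] M) (s : S) (hs : ∀ x, β (α x) = s • x)
    (φ : Module.Dual S (LinearMap.ker π)) :
    s • φ ∈ LinearMap.range (LinearMap.ker π).dualRestrict := by
  obtain ⟨γ, hγ⟩ := Module.projective_lifting_property π β hπ
  let r : F0 →ₗ[S] LinearMap.ker π :=
    LinearMap.codRestrict _ (s • LinearMap.id - γ.comp (α.comp π)) (by
      intro x
      rw [LinearMap.mem_ker]
      have : π (γ (α (π x))) = β (α (π x)) := congrArg (fun g : _ →ₗ[S] _ => g (α (π x))) hγ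
      simp [this, hs])
  refine ⟨φ.comp r, ?_⟩
  ext x
  have : r x = s • x := by
    ext
    have hx : π x = 0 := x.2
    simp [r, hx]
  simp [this]

theorem local_split [IsDomain S] [IsNoetherianRing S] {D : Type} [AddCommGroup D] [Module S D]
    [Module.Finite S D] (htf : ∀ (s : S) (x : D), s ≠ 0 → s • x = 0 → x = 0)
    (p : Ideal S) [hp : p.IsPrime]
    (hfree : Module.Free (Localization.AtPrime p) (LocalizedModule p.primeCompl D)) :
    ∃ s ∉ p, ∃ (κ : Type) (_ : Finite κ) (i : D →ₗ[S] (κ →₀ S)) (j : (κ →₀ S) →ₗ[S] D),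
      ∀ x, j (i x) = s • x := by
  let b := Module.Free.chooseBasis (Localization.AtPrime p) (LocalizedModule p.primeCompl D)
  let κ := Module.Free.ChooseBasisIndex (Localization.AtPrime p) (LocalizedModule p.primeCompl D)
  have : Module.FinitePresentation S D := Module.finitePresentation_of_finite S D
  have hκ : Finite κ := inferInstance
  let e := b.repr.restrictScalars S
  let l : (κ →₀ S) →ₗ[S] (κ →₀ Localization.AtPrime p) :=
    Finsupp.mapRange.linearMap (Algebra.linearMap S (Localization.AtPrime p))
  let mk := LocalizedModule.mkLinearMap p.primeCompl D
  obtain ⟨j, s1, hj⟩ := Module.FinitePresentation.exists_lift_of_isLocalizedModule p.primeCompl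
    mk (e.symm.toLinearMap.comp l)
  obtain ⟨i, s2, hi⟩ := Module.FinitePresentation.exists_lift_of_isLocalizedModule p.primeCompl
    l (e.toLinearMap.comp mk)
  refine ⟨s1 * s2, fun h => ?_, κ, hκ, i, j, fun x => ?_⟩
  · exact (hp.mem_or_mem h).elim s1.2 s2.2
  · have h1 := congrArg (fun g : _ →ₗ[S] _ => g (i x)) hj
    have h2 := congrArg (fun g : _ →ₗ[S] _ => g x) hi
    change mk (j (i x)) = (s1 : S) • e.symm (l (i x)) at h1
    change l (i x) = (s2 : S) • e (mk x) at h2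
    rw [h2, map_smul, LinearEquiv.symm_apply_apply, smul_smul, ← map_smul] at h1
    obtain ⟨c, hc⟩ := (IsLocalizedModule.eq_iff_exists p.primeCompl mk).1 h1
    rw [← sub_eq_zero]
    apply htf c _ (fun h0 => c.2 (by rw [h0]; exact p.zero_mem))
    rw [smul_sub, sub_eq_zero]
    exact hc

theorem omega_projective [IsDomain S] [IsNoetherianRing S] {D : Type} [AddCommGroup D]
    [Module S D] [Module.Finite S D] (htf : ∀ (s : S) (x : D), s ≠ 0 → s • x = 0 → x = 0)
    (m : Ideal S)
    (hloc : ∀ (p : Ideal S) (_ : p.IsPrime), p ≠ m →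
      Module.Free (Localization.AtPrime p) (LocalizedModule p.primeCompl D))
    (hpd : pdLE S (ModuleCat.of S (Module.Dual S D)) 1)
    {a b c : S} (ha : a ∈ m) (hb : b ∈ m) (hc : c ∈ m) (H : RegTriple ⊥ a b c)
    {G : Type} [AddCommGroup G] [Module S G] [Module.Free S G] [Module.Finite S G]
    (u : G →ₗ[S] S)
    (hu : ∀ x, a * x ∈ LinearMap.range u → b * x ∈ LinearMap.range u →
      c * x ∈ LinearMap.range u → x ∈ LinearMap.range u)
    (eD : Module.Dual S (Module.Dual S D) ≃ₗ[S] LinearMap.ker u) :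
    Module.Projective S (Module.Dual S D) := by
  obtain ⟨n, π, hπ⟩ := Module.Finite.exists_fin' S (Module.Dual S D)
  have hF1 := ker_projective S _ _ π hπ hpd
  apply proj_of_extend π hπ
  by_contra hns
  rw [← LinearMap.range_eq_top] at hns
  have : Nontrivial (Module.Dual S (LinearMap.ker π) ⧸
      LinearMap.range (LinearMap.ker π).dualRestrict) :=
    Submodule.Quotient.nontrivial_iff.2 hns
  obtain ⟨p, hp⟩ := associatedPrimes.nonempty S (Module.Dual S (LinearMap.ker π) ⧸
      LinearMap.range (LinearMap.ker π).dualRestrict)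
  obtain ⟨hpp, φ, hφ⟩ := (isAssociatedPrime_iff).1 hp
  obtain ⟨φ, rfl⟩ := Submodule.Quotient.mk_surjective _ φ
  have hmem : ∀ r, r ∈ p ↔ r • φ ∈ LinearMap.range (LinearMap.ker π).dualRestrict := by
    intro r
    rw [hφ, Submodule.mem_colon_singleton, Submodule.mem_bot, ← Submodule.Quotient.mk_smul,
      Submodule.Quotient.mk_eq_zero]
  by_cases hpm : p = m
  · subst hpm
    have e1 : LinearMap.ker (LinearMap.ker π).dualRestrict ≃ₗ[S]
        Module.Dual S (Module.Dual S D) :=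
      (LinearEquiv.ofEq _ _ (LinearMap.ker π).dualRestrict_ker_eq_dualAnnihilator).trans
        ((LinearMap.ker π).dualQuotEquivDualAnnihilator.symm.trans
          (π.quotKerEquivOfSurjective hπ).symm.dualMap)
    have a0 : a ≠ 0 := by
      rintro rfl
      exact one_ne_zero (H.h1 1 (by simp))
    have := H.lemmaB u hu (M1 := Module.Dual S (LinearMap.ker π)) (by
      intro x hx
      ext z
      have := congrArg (fun g : Module.Dual S (LinearMap.ker π) => g z) hx
      exact (mul_eq_zero.1 this).resolve_left a0) (LinearMap.ker π).dualRestrict (e1.trans eD) φ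
      ((hmem a).1 ha) ((hmem b).1 hb) ((hmem c).1 hc)
    apply hpp.ne_top
    rw [Ideal.eq_top_iff_one, hmem, one_smul]
    exact this
  · obtain ⟨s, hs, κ, hκ, i, j, hij⟩ := local_split htf p (hloc p hpp hpm)
    apply hs
    rw [hmem]
    refine extend_up π hπ j.dualMap i.dualMap s (fun x => ?_) φ
    ext y
    simp [hij]
end Homological

section Reflexive
variable {K : Type} [Field K] {ℓ : ℕ} {f : MvPolynomial (Fin ℓ) K}

theorem fsmul_mem_Dlog (v : Fin ℓ → MvPolynomial (Fin ℓ) K) : f • v ∈ Dlog K ℓ f := by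
  rw [mem_Dlog]
  refine Finset.dvd_sum fun i _ => ?_
  rw [Pi.smul_apply, smul_eq_mul, mul_assoc]
  exact Dvd.intro _ rfl

theorem eval_bijective (hf0 : f ≠ 0) :
    Function.Bijective (Module.Dual.eval (MvPolynomial (Fin ℓ) K) (Dlog K ℓ f)) := by
  let dx : Fin ℓ → Module.Dual (MvPolynomial (Fin ℓ) K) (Dlog K ℓ f) := fun i =>
    (LinearMap.proj i).comp (Dlog K ℓ f).subtype
  constructor
  · intro θ θ' h
    ext1
    funext i
    exact congrArg (fun ψ : Module.Dual _ (Module.Dual _ (Dlog K ℓ f)) => ψ (dx i)) h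
  · intro ψ
    let lam : Module.Dual (MvPolynomial (Fin ℓ) K) (Dlog K ℓ f) :=
      ((LinearMap.snd _ _ _).comp (LinearMap.ker (uMap f)).subtype).comp
        (kerUEquiv hf0).symm.toLinearMap
    have hlam : ∀ θ : Dlog K ℓ f, ∑ i, pderiv i f * θ.1 i = f * lam θ := by
      intro θ
      obtain ⟨p, rfl⟩ := (kerUEquiv hf0).surjective θ
      have := p.2
      rw [LinearMap.mem_ker, uMap_apply, sub_eq_zero] at this
      have h1 : lam (kerUEquiv hf0 p) = p.1.2 := by simp [lam]
      rw [h1, mul_comm f, ← this]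
      exact Finset.sum_congr rfl fun i _ => mul_comm _ _
    have h1 : ∑ i, pderiv i f • dx i = f • lam := by
      ext θ
      simpa [dx] using congrArg _ (hlam θ)
    let θ0 : Fin ℓ → MvPolynomial (Fin ℓ) K := fun i => ψ (dx i)
    have hθ0 : θ0 ∈ Dlog K ℓ f := by
      rw [mem_Dlog]
      refine ⟨ψ lam, ?_⟩
      rw [← smul_eq_mul, ← map_smul, ← h1, map_sum]
      refine Finset.sum_congr rfl fun i _ => ?_
      rw [map_smul, smul_eq_mul, mul_comm]
    let b : Fin ℓ → Dlog K ℓ f := fun i => ⟨f • Pi.single i 1, fsmul_mem_Dlog _⟩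
    have hb : ∀ θ : Dlog K ℓ f, f • θ = ∑ i, θ.1 i • b i := by
      intro θ
      ext1
      rw [Submodule.coe_sum]
      funext j
      simp [b, Finset.sum_apply, Pi.single_apply, mul_comm]
    refine ⟨⟨θ0, hθ0⟩, ?_⟩
    refine LinearMap.ext fun φ => ?_
    rw [Module.Dual.eval_apply]
    apply mul_left_cancel₀ hf0
    have h2 : f • φ = ∑ i, φ (b i) • dx i := by
      refine LinearMap.ext fun θ => ?_
      have : φ (f • θ) = φ (∑ i, θ.1 i • b i) := by rw [hb θ]
      rw [map_smul, map_sum] at this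
      rw [LinearMap.smul_apply, this]
      simp [dx, mul_comm]
    have h3 : φ (f • ⟨θ0, hθ0⟩) = φ (∑ i, θ0 i • b i) := by rw [hb ⟨θ0, hθ0⟩]
    have h4 : ψ (f • φ) = ψ (∑ i, φ (b i) • dx i) := by rw [h2]
    rw [map_smul, smul_eq_mul, map_sum] at h3 h4
    rw [h3, h4]
    refine Finset.sum_congr rfl fun i _ => ?_
    rw [map_smul, map_smul, smul_eq_mul, smul_eq_mul, mul_comm]

/-- the prime generated by the variables in `A` -/
noncomputable def varPrime (K : Type) [Field K] {ℓ : ℕ} (A : Finset (Fin ℓ)) :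
    PrimeSpectrum (MvPolynomial (Fin ℓ) K) :=
  ⟨RingHom.ker (aeval (fun i => if i ∈ A then (0 : MvPolynomial (Fin ℓ) K) else X i) :
    MvPolynomial (Fin ℓ) K →ₐ[K] MvPolynomial (Fin ℓ) K), RingHom.ker_isPrime _⟩

theorem X_mem_varPrime (A : Finset (Fin ℓ)) (i : Fin ℓ) :
    X i ∈ (varPrime K A).asIdeal ↔ i ∈ A := by
  change aeval _ (X i) = 0 ↔ _
  rw [aeval_X]
  split_ifs with h <;> simp [h]

theorem varPrime_le (A : Finset (Fin ℓ)) (q : PrimeSpectrum (MvPolynomial (Fin ℓ) K))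
    (h : ∀ i ∈ A, X i ∈ q.asIdeal) : varPrime K A ≤ q := by
  intro g hg
  have hg' : aeval (fun i => if i ∈ A then (0 : MvPolynomial (Fin ℓ) K) else X i) g = 0 := hg
  have e : (Ideal.Quotient.mkₐ K q.asIdeal).comp
      (aeval (fun i => if i ∈ A then (0 : MvPolynomial (Fin ℓ) K) else X i)) =
      Ideal.Quotient.mkₐ K q.asIdeal := by
    ext i
    rw [AlgHom.comp_apply, aeval_X]
    split_ifs with hi
    · rw [map_zero]
      exact (Ideal.Quotient.eq_zero_iff_mem.2 (h i hi)).symm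
    · rfl
  have h2 := congrArg (fun F : _ →ₐ[K] _ => F g) e
  simp only [AlgHom.comp_apply, hg', map_zero] at h2
  exact Ideal.Quotient.eq_zero_iff_mem.1 h2.symm

theorem height_ge_three (q : PrimeSpectrum (MvPolynomial (Fin ℓ) K)) (y1 y2 y3 : Fin ℓ)
    (h12 : y1 ≠ y2) (h13 : y1 ≠ y3) (h23 : y2 ≠ y3) (h1 : X y1 ∈ q.asIdeal)
    (h2 : X y2 ∈ q.asIdeal) (h3 : X y3 ∈ q.asIdeal) : 3 ≤ Order.height q := by
  have key : ∀ (A : Finset (Fin ℓ)) (y : Fin ℓ), y ∉ A →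
      varPrime K A < varPrime K (insert y A) := by
    intro A y hy
    refine lt_of_le_of_ne (varPrime_le _ _ fun i hi => (X_mem_varPrime _ _).2
      (Finset.mem_insert_of_mem hi)) fun e => hy ?_
    rw [← X_mem_varPrime (K := K), e, X_mem_varPrime]
    exact Finset.mem_insert_self _ _
  have a1 := Order.height_add_one_le (key ∅ y3 (by simp))
  have a2 := Order.height_add_one_le (key {y3} y2 (by simpa using h23))
  have a3 := Order.height_add_one_le (key {y2, y3} y1 (by simp [h12, h13]))
  have a4 := Order.height_mono (varPrime_le {y1, y2, y3} q (by
    intro i hi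
    simp only [Finset.mem_insert, Finset.mem_singleton] at hi
    rcases hi with rfl | rfl | rfl <;> assumption))
  calc (3 : ℕ∞) = 0 + 1 + 1 + 1 := by norm_num
    _ ≤ Order.height (varPrime K (∅ : Finset (Fin ℓ))) + 1 + 1 + 1 := by gcongr; exact zero_le
    _ ≤ Order.height (varPrime K {y3}) + 1 + 1 := by gcongr; exact a1
    _ ≤ Order.height (varPrime K {y2, y3}) + 1 := by gcongr
    _ ≤ _ := a3
    _ ≤ _ := a4

theorem Dlog_projective (hf0 : f ≠ 0) (hJ : f ∈ jacobianIdeal K ℓ f)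
    (hloc : ∀ (p : Ideal (MvPolynomial (Fin ℓ) K)) (_ : p.IsPrime),
      p ≠ Ideal.span (Set.range (X : Fin ℓ → MvPolynomial (Fin ℓ) K)) →
      Module.Free (Localization.AtPrime p) (LocalizedModule p.primeCompl (Dlog K ℓ f)))
    (hpd : pdLE (MvPolynomial (Fin ℓ) K)
      (ModuleCat.of (MvPolynomial (Fin ℓ) K)
        (Module.Dual (MvPolynomial (Fin ℓ) K) (Dlog K ℓ f))) 1)
    (hpure : ∀ (q : Ideal (MvPolynomial (Fin ℓ) K)) (hq : q.IsPrime),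
      q ∈ associatedPrimes (MvPolynomial (Fin ℓ) K)
        (MvPolynomial (Fin ℓ) K ⧸ jacobianIdeal K ℓ f) →
      Order.height (⟨q, hq⟩ : PrimeSpectrum (MvPolynomial (Fin ℓ) K)) = 2)
    (y1 y2 y3 : Fin ℓ) (h12 : y1 ≠ y2) (h13 : y1 ≠ y3) (h23 : y2 ≠ y3) :
    Module.Projective (MvPolynomial (Fin ℓ) K) (Dlog K ℓ f) := by
  have eD : Dlog K ℓ f ≃ₗ[MvPolynomial (Fin ℓ) K]
      Module.Dual (MvPolynomial (Fin ℓ) K) (Module.Dual (MvPolynomial (Fin ℓ) K) (Dlog K ℓ f)) :=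
    LinearEquiv.ofBijective _ (eval_bijective hf0)
  have hX : ∀ i, (X i : MvPolynomial (Fin ℓ) K) ∈
      Ideal.span (Set.range (X : Fin ℓ → MvPolynomial (Fin ℓ) K)) :=
    fun i => Ideal.subset_span ⟨i, rfl⟩
  have hproj := omega_projective (S := MvPolynomial (Fin ℓ) K) (D := Dlog K ℓ f)
    (fun s x hs hx => (smul_eq_zero.1 hx).resolve_left hs) _ hloc hpd (hX y1) (hX y2) (hX y3)
    (regTriple_X y1 y2 y3 h12 h13 h23) (uMap f) (by
      intro x hx1 hx2 hx3
      rw [range_uMap hJ] at *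
      by_contra hx
      obtain ⟨q, hq, hle⟩ := exists_le_isAssociatedPrime_of_isNoetherianRing
        (MvPolynomial (Fin ℓ) K) (Ideal.Quotient.mk (jacobianIdeal K ℓ f) x)
        (fun h => hx (Ideal.Quotient.eq_zero_iff_mem.1 h))
      have hmem : ∀ r, r * x ∈ jacobianIdeal K ℓ f → r ∈ q := by
        intro r hr
        apply hle
        rw [Submodule.mem_colon_singleton, Submodule.mem_bot]
        change Ideal.Quotient.mk (jacobianIdeal K ℓ f) (r * x) = 0
        rwa [Ideal.Quotient.eq_zero_iff_mem]
      have h2 := hpure q hq.isPrime hq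
      have h3 := height_ge_three ⟨q, hq.isPrime⟩ y1 y2 y3 h12 h13 h23 (hmem _ hx1) (hmem _ hx2)
        (hmem _ hx3)
      rw [h2] at h3
      exact absurd h3 (by decide)) (eD.symm.trans (kerUEquiv hf0).symm)
  exact Module.Projective.of_equiv eD.symm
end Reflexive

section Graded
variable {K : Type} [Field K] {ℓ : ℕ} {f : MvPolynomial (Fin ℓ) K}

/-- shifted homogeneous component -/
noncomputable def shiftComp (n e : ℕ) (c : MvPolynomial (Fin ℓ) K) : MvPolynomial (Fin ℓ) K :=
  if e ≤ n then homogeneousComponent (n - e) c else 0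

theorem comp_mul (n e : ℕ) (c g : MvPolynomial (Fin ℓ) K) (hg : g.IsHomogeneous e) :
    homogeneousComponent n (c * g) = shiftComp n e c * g := by
  have h1 : c * g = ∑ k ∈ Finset.range (c.totalDegree + 1), homogeneousComponent k c * g := by
    rw [← Finset.sum_mul, sum_homogeneousComponent]
  have h2 : ∀ k, homogeneousComponent n (homogeneousComponent k c * g) =
      if n = k + e then homogeneousComponent k c * g else 0 := fun k =>
    homogeneousComponent_of_mem
      ((mem_homogeneousSubmodule _ _).2 ((homogeneousComponent_isHomogeneous k c).mul hg))
  rw [h1, map_sum, Finset.sum_congr rfl fun k _ => h2 k, shiftComp]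
  split_ifs with hen
  · by_cases hk : n - e < c.totalDegree + 1
    · rw [Finset.sum_eq_single (n - e)]
      · rw [if_pos (by omega)]
      · intro k _ hk'
        rw [if_neg (by omega)]
      · intro h
        exact absurd (Finset.mem_range.2 hk) h
    · rw [homogeneousComponent_eq_zero _ _ (by omega), zero_mul]
      refine Finset.sum_eq_zero fun k hk' => ?_
      rw [Finset.mem_range] at hk'
      rw [if_neg (by omega)]
  · rw [zero_mul]
    exact Finset.sum_eq_zero fun k _ => if_neg (by omega)

theorem comp_mem_Dlog {d : ℕ} (hf : f.IsHomogeneous d) (θ : Fin ℓ → MvPolynomial (Fin ℓ) K)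
    (hθ : θ ∈ Dlog K ℓ f) (n : ℕ) : (fun i => homogeneousComponent n (θ i)) ∈ Dlog K ℓ f := by
  rw [mem_Dlog] at *
  obtain ⟨h, hh⟩ := hθ
  refine ⟨shiftComp (n + (d - 1)) d h, ?_⟩
  have h1 := congrArg (homogeneousComponent (n + (d - 1))) hh
  rw [mul_comm f h, comp_mul _ d _ _ hf, map_sum] at h1
  rw [mul_comm f, ← h1]
  refine Finset.sum_congr rfl fun i _ => ?_
  rw [comp_mul _ (d - 1) _ _ hf.pderiv, shiftComp, if_pos (by omega), Nat.add_sub_cancel]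

theorem span_hom {d : ℕ} (hf : f.IsHomogeneous d) :
    Submodule.span (MvPolynomial (Fin ℓ) K)
      {θ | θ ∈ Dlog K ℓ f ∧ ∃ e, ∀ i, (θ i).IsHomogeneous e} = Dlog K ℓ f := by
  apply le_antisymm
  · rw [Submodule.span_le]
    exact fun θ h => h.1
  · intro θ hθ
    let N := Finset.univ.sup fun i => (θ i).totalDegree
    have h1 : θ = ∑ n ∈ Finset.range (N + 1), fun i => homogeneousComponent n (θ i) := by
      funext i
      rw [Finset.sum_apply]
      conv_lhs => rw [← sum_homogeneousComponent (θ i)]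
      have hle : (θ i).totalDegree ≤ N :=
        Finset.le_sup (f := fun i => (θ i).totalDegree) (Finset.mem_univ i)
      refine Finset.sum_subset (by gcongr) fun k _ hk => ?_
      rw [Finset.mem_range] at hk
      exact homogeneousComponent_eq_zero _ _ (by omega)
    rw [h1]
    exact Submodule.sum_mem _ fun n _ => Submodule.subset_span
      ⟨comp_mem_Dlog hf θ hθ n, n, fun i => homogeneousComponent_isHomogeneous _ _⟩

theorem exists_min_gens {d : ℕ} (hf : f.IsHomogeneous d) :
    ∃ s : Finset (Fin ℓ → MvPolynomial (Fin ℓ) K),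
      Submodule.span (MvPolynomial (Fin ℓ) K) (s : Set (Fin ℓ → MvPolynomial (Fin ℓ) K)) =
        Dlog K ℓ f ∧
      ∀ c : (Fin ℓ → MvPolynomial (Fin ℓ) K) → MvPolynomial (Fin ℓ) K,
        ∑ g ∈ s, c g • g = 0 → ∀ g ∈ s, coeff 0 (c g) = 0 := by
  classical
  have hex : ∃ n, ∃ s : Finset (Fin ℓ → MvPolynomial (Fin ℓ) K), s.card = n ∧
      (↑s ⊆ {θ | θ ∈ Dlog K ℓ f ∧ ∃ e, ∀ i, (θ i).IsHomogeneous e}) ∧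
      Submodule.span (MvPolynomial (Fin ℓ) K) (s : Set (Fin ℓ → MvPolynomial (Fin ℓ) K)) =
        Dlog K ℓ f := by
    have hfg : (Dlog K ℓ f).FG := IsNoetherian.noetherian _
    rw [← span_hom hf, Submodule.fg_span_iff_fg_span_finset_subset] at hfg
    obtain ⟨s, hs, e⟩ := hfg
    exact ⟨_, s, rfl, hs, by rw [← e, span_hom hf]⟩
  obtain ⟨s, hcard, hs, hspan⟩ := Nat.find_spec hex
  refine ⟨s, hspan, fun c hc g hg => ?_⟩
  by_contra h0
  choose! e he using fun g (hg : g ∈ s) => (hs hg).2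
  have h1 : ∑ g' ∈ s, shiftComp (e g) (e g') (c g') • g' = 0 := by
    funext i
    have h2 := congrArg (homogeneousComponent (e g)) (congrFun hc i)
    rw [Finset.sum_apply, map_sum, Pi.zero_apply, map_zero] at h2
    rw [Finset.sum_apply, Pi.zero_apply, ← h2]
    refine Finset.sum_congr rfl fun g' hg' => ?_
    rw [Pi.smul_apply, Pi.smul_apply, smul_eq_mul, smul_eq_mul,
      comp_mul _ (e g') _ _ (he g' hg' i)]
  rw [← Finset.add_sum_erase _ _ hg, shiftComp, if_pos le_rfl, Nat.sub_self,
    homogeneousComponent_zero] at h1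
  have h3 : g ∈ Submodule.span (MvPolynomial (Fin ℓ) K)
      ((s.erase g : Finset _) : Set (Fin ℓ → MvPolynomial (Fin ℓ) K)) := by
    have h4 : g = (C (coeff 0 (c g))⁻¹ : MvPolynomial (Fin ℓ) K) •
        (-∑ g' ∈ s.erase g, shiftComp (e g) (e g') (c g') • g') := by
      rw [← eq_neg_of_add_eq_zero_left h1, smul_smul, ← C_mul, inv_mul_cancel₀ h0, C_1, one_smul]
    have h5 : (C (coeff 0 (c g))⁻¹ : MvPolynomial (Fin ℓ) K) •
        (-∑ g' ∈ s.erase g, shiftComp (e g) (e g') (c g') • g') ∈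
        Submodule.span (MvPolynomial (Fin ℓ) K)
          ((s.erase g : Finset _) : Set (Fin ℓ → MvPolynomial (Fin ℓ) K)) := by
      refine Submodule.smul_mem _ _ (Submodule.neg_mem _ (Submodule.sum_mem _ fun g' hg' => ?_))
      exact Submodule.smul_mem _ _ (Submodule.subset_span hg')
    rwa [← h4] at h5
  refine Nat.find_min hex (m := (s.erase g).card) ?_ ⟨s.erase g, rfl, ?_, ?_⟩
  · rw [← hcard]
    exact Finset.card_erase_lt_of_mem hg
  · exact fun x hx => hs (Finset.mem_of_mem_erase hx)
  · rw [← hspan]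
    apply le_antisymm (Submodule.span_mono (Finset.coe_subset.2 (Finset.erase_subset _ _)))
    rw [Submodule.span_le]
    intro x hx
    by_cases hxg : x = g
    · rw [hxg]; exact h3
    · exact Submodule.subset_span (Finset.mem_coe.2 (Finset.mem_erase.2 ⟨hxg, hx⟩))

theorem mem_vars_of_coeff (p : MvPolynomial (Fin ℓ) K) (hp : coeff 0 p = 0) :
    p ∈ Ideal.span (Set.range (X : Fin ℓ → MvPolynomial (Fin ℓ) K)) := by
  have key : ∀ p : MvPolynomial (Fin ℓ) K, p - C (coeff 0 p) ∈
      Ideal.span (Set.range (X : Fin ℓ → MvPolynomial (Fin ℓ) K)) := by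
    intro p
    induction p using MvPolynomial.induction_on with
    | C r => simp
    | add a b ha hb =>
      have := Ideal.add_mem _ ha hb
      rw [coeff_add, C_add]
      convert this using 1
      ring
    | mul_X a i _ =>
      have : coeff 0 (a * X i) = 0 := by
        simpa [constantCoeff_eq] using constantCoeff.map_mul a (X i : MvPolynomial (Fin ℓ) K)
      rw [this, C_0, sub_zero]
      exact Ideal.mul_mem_left _ _ (Ideal.subset_span ⟨i, rfl⟩)
  have := key p
  rwa [hp, C_0, sub_zero] at this

theorem one_not_mem_vars :
    (1 : MvPolynomial (Fin ℓ) K) ∉ Ideal.span (Set.range (X : Fin ℓ → MvPolynomial (Fin ℓ) K)) := by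
  intro h
  have hle : Ideal.span (Set.range (X : Fin ℓ → MvPolynomial (Fin ℓ) K)) ≤
      RingHom.ker (constantCoeff : MvPolynomial (Fin ℓ) K →+* K) := by
    rw [Ideal.span_le]
    rintro _ ⟨i, rfl⟩
    exact constantCoeff_X (R := K) i
  have := hle h
  rw [RingHom.mem_ker, map_one] at this
  exact one_ne_zero this

/-- a minimal presentation of `D(f)` -/
theorem exists_min_pres {d : ℕ} (hf : f.IsHomogeneous d) :
    ∃ (ι : Type) (_ : Fintype ι) (P : (ι → MvPolynomial (Fin ℓ) K) →ₗ[MvPolynomial (Fin ℓ) K]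
      Dlog K ℓ f), Function.Surjective P ∧ ∀ c, P c = 0 → ∀ i, c i ∈
        Ideal.span (Set.range (X : Fin ℓ → MvPolynomial (Fin ℓ) K)) := by
  classical
  obtain ⟨s, hs, hmin⟩ := exists_min_gens hf
  let g : s → Dlog K ℓ f := fun x => ⟨x.1, by rw [← hs]; exact Submodule.subset_span x.2⟩
  refine ⟨s, inferInstance, Fintype.linearCombination _ g, ?_, ?_⟩
  · intro θ
    have h1 : (θ : Fin ℓ → MvPolynomial (Fin ℓ) K) ∈ Submodule.span (MvPolynomial (Fin ℓ) K)
        (s : Set (Fin ℓ → MvPolynomial (Fin ℓ) K)) := by rw [hs]; exact θ.2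
    obtain ⟨c, -, hc⟩ := Submodule.mem_span_finset.1 h1
    refine ⟨fun x => c x.1, ?_⟩
    ext1
    rw [← hc, Fintype.linearCombination_apply, Submodule.coe_sum, ← Finset.sum_coe_sort s]
    rfl
  · intro c hc i
    apply mem_vars_of_coeff
    have h2 := hmin (fun x => if hx : x ∈ s then c ⟨x, hx⟩ else 0) (by
      rw [← Finset.sum_coe_sort s]
      have := congrArg Subtype.val hc
      rw [Fintype.linearCombination_apply, Submodule.coe_sum] at this
      refine Eq.trans ?_ this
      refine Finset.sum_congr rfl fun x _ => ?_
      rw [dif_pos x.2]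
      rfl) i i.2
    rwa [dif_pos i.2] at h2

theorem free_of_nakayama {D ι : Type} [AddCommGroup D] [Module (MvPolynomial (Fin ℓ) K) D]
    [Fintype ι]
    (P : (ι → MvPolynomial (Fin ℓ) K) →ₗ[MvPolynomial (Fin ℓ) K] D) (hP : Function.Surjective P)
    (hN : LinearMap.ker P ≤ Ideal.span (Set.range (X : Fin ℓ → MvPolynomial (Fin ℓ) K)) •
      LinearMap.ker P) : Module.Free (MvPolynomial (Fin ℓ) K) D := by
  obtain ⟨r, hr, hr2⟩ := Submodule.exists_sub_one_mem_and_smul_eq_zero_of_fg_of_le_smul _ _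
    (IsNoetherian.noetherian _) hN
  have hr0 : r ≠ 0 := by
    rintro rfl
    rw [zero_sub] at hr
    exact one_not_mem_vars (by simpa using Ideal.neg_mem_iff _ |>.2 hr)
  have hinj : Function.Injective P := by
    rw [← LinearMap.ker_eq_bot, Submodule.eq_bot_iff]
    intro x hx
    exact (smul_eq_zero.1 (hr2 x hx)).resolve_left hr0
  exact Module.Free.of_equiv (LinearEquiv.ofBijective P ⟨hinj, hP⟩)

theorem free_of_projective {D ι : Type} [AddCommGroup D] [Module (MvPolynomial (Fin ℓ) K) D]
    [Fintype ι] [Module.Projective (MvPolynomial (Fin ℓ) K) D]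
    (P : (ι → MvPolynomial (Fin ℓ) K) →ₗ[MvPolynomial (Fin ℓ) K] D) (hP : Function.Surjective P)
    (hm : ∀ c, P c = 0 → ∀ i, c i ∈
        Ideal.span (Set.range (X : Fin ℓ → MvPolynomial (Fin ℓ) K))) :
    Module.Free (MvPolynomial (Fin ℓ) K) D := by
  classical
  apply free_of_nakayama P hP
  obtain ⟨σ, hσ⟩ := Module.projective_lifting_property P LinearMap.id hP
  have hσ' : ∀ x, P (σ x) = x := fun x => congrArg (fun g : _ →ₗ[_] _ => g x) hσ
  intro c hc
  let ρ := LinearMap.id - σ.comp P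
  have h1 : c = ∑ i, c i • ρ (Pi.single i 1) := by
    have h2 : ρ c = c := by
      have : P c = 0 := hc
      simp [ρ, this]
    conv_lhs => rw [← h2, pi_eq_sum_univ' c]
    rw [map_sum]
    exact Finset.sum_congr rfl fun i _ => map_smul _ _ _
  rw [h1]
  refine Submodule.sum_mem _ fun i _ => Submodule.smul_mem_smul (hm c hc i) ?_
  rw [LinearMap.mem_ker]
  simp [ρ, hσ']

theorem free_one {D ι : Type} [AddCommGroup D] [Module (MvPolynomial (Fin 1) K) D]
    [Fintype ι] (htf : ∀ (s : MvPolynomial (Fin 1) K) (x : D), s ≠ 0 → s • x = 0 → x = 0)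
    (P : (ι → MvPolynomial (Fin 1) K) →ₗ[MvPolynomial (Fin 1) K] D) (hP : Function.Surjective P)
    (hm : ∀ c, P c = 0 → ∀ i, c i ∈
        Ideal.span (Set.range (X : Fin 1 → MvPolynomial (Fin 1) K))) :
    Module.Free (MvPolynomial (Fin 1) K) D := by
  apply free_of_nakayama P hP
  intro c hc
  have h1 : ∀ i, ∃ p, c i = X 0 * p := by
    intro i
    have h := hm c hc i
    rw [Set.range_unique] at h
    obtain ⟨p, hp⟩ := Ideal.mem_span_singleton.1 h
    exact ⟨p, hp⟩
  choose p hp using h1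
  have hcp : c = (X 0 : MvPolynomial (Fin 1) K) • p := funext hp
  rw [hcp]
  refine Submodule.smul_mem_smul (Ideal.subset_span ⟨0, rfl⟩) ?_
  rw [LinearMap.mem_ker] at hc ⊢
  rw [hcp, map_smul] at hc
  exact htf _ _ (X_ne_zero 0) hc

theorem two_coprime (a b : MvPolynomial (Fin 2) K) (h : X 0 * a = X 1 * b) :
    ∃ w, a = X 1 * w ∧ b = X 0 * w := by
  have h1 : (X 1 : MvPolynomial (Fin 2) K) ∣ X 0 * a := ⟨b, h⟩
  obtain ⟨w, rfl⟩ := ((X_prime (i := (1 : Fin 2)) (R := K)).dvd_or_dvd h1).resolve_left (by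
    rw [X_dvd_X]; decide)
  refine ⟨w, rfl, ?_⟩
  apply mul_left_cancel₀ (X_ne_zero (R := K) (1 : Fin 2))
  linear_combination -h

theorem free_two {f : MvPolynomial (Fin 2) K} (hf0 : f ≠ 0) {ι : Type} [Fintype ι]
    (P : (ι → MvPolynomial (Fin 2) K) →ₗ[MvPolynomial (Fin 2) K] Dlog K 2 f)
    (hP : Function.Surjective P)
    (hm : ∀ c, P c = 0 → ∀ i, c i ∈
        Ideal.span (Set.range (X : Fin 2 → MvPolynomial (Fin 2) K))) :
    Module.Free (MvPolynomial (Fin 2) K) (Dlog K 2 f) := by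
  apply free_of_nakayama P hP
  intro c hc
  have h1 : ∀ i, ∃ p q, c i = X 0 * p + X 1 * q := by
    intro i
    obtain ⟨r, hr⟩ := Ideal.mem_span_range_iff_exists_fun.1 (hm c hc i)
    rw [Fin.sum_univ_two] at hr
    exact ⟨r 0, r 1, by rw [← hr]; ring⟩
  choose p q hpq using h1
  have hcp : c = (X 0 : MvPolynomial (Fin 2) K) • p + (X 1 : MvPolynomial (Fin 2) K) • q :=
    funext hpq
  have hc0 : P c = 0 := hc
  rw [hcp, map_add, map_smul, map_smul] at hc0
  have h2 : ∀ k, ∃ w, (P p).1 k = X 1 * w ∧ -(P q).1 k = X 0 * w := by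
    intro k
    apply two_coprime
    have := congrFun (congrArg Subtype.val hc0) k
    simp only [Submodule.coe_add, Submodule.coe_smul, Pi.add_apply, Pi.smul_apply, smul_eq_mul,
      Submodule.coe_zero, Pi.zero_apply] at this
    linear_combination this
  choose w hw1 hw2 using h2
  have hwD : w ∈ Dlog K 2 f := by
    obtain ⟨a, ha⟩ := (mem_Dlog _).1 (P p).2
    obtain ⟨b, hb⟩ := (mem_Dlog _).1 (P q).2
    rw [mem_Dlog]
    have ha' : X 1 * ∑ i, w i * pderiv i f = f * a := by
      rw [← ha, Finset.mul_sum]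
      exact Finset.sum_congr rfl fun i _ => by rw [hw1]; ring
    have hb' : X 0 * ∑ i, w i * pderiv i f = f * (-b) := by
      rw [mul_neg, ← hb, Finset.mul_sum, ← Finset.sum_neg_distrib]
      exact Finset.sum_congr rfl fun i _ => by linear_combination -hw2 i * pderiv i f
    obtain ⟨h, h3, h4⟩ := two_coprime a (-b) (by
      apply mul_left_cancel₀ hf0
      linear_combination -(X 0) * ha' + X 1 * hb')
    refine ⟨h, ?_⟩
    apply mul_left_cancel₀ (X_ne_zero (R := K) (1 : Fin 2))
    rw [ha', h3]
    ring
  obtain ⟨v, hv⟩ := hP ⟨w, hwD⟩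
  have hcv : c = (X 0 : MvPolynomial (Fin 2) K) • (p - (X 1 : MvPolynomial (Fin 2) K) • v) +
      (X 1 : MvPolynomial (Fin 2) K) • (q + (X 0 : MvPolynomial (Fin 2) K) • v) := by
    rw [hcp]; module
  rw [hcv]
  refine Submodule.add_mem _ (Submodule.smul_mem_smul (Ideal.subset_span ⟨0, rfl⟩) ?_)
    (Submodule.smul_mem_smul (Ideal.subset_span ⟨1, rfl⟩) ?_)
  · rw [LinearMap.mem_ker, map_sub, map_smul, hv]
    ext1
    funext k
    simp [hw1]
  · rw [LinearMap.mem_ker, map_add, map_smul, hv]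
    ext1
    funext k
    simp [← hw2]
end Graded

/-- Let `K` be a field of characteristic zero, `S = K[x_1, …, x_ℓ]`, and `f ∈ S` nonzero,
squarefree and homogeneous of degree `≥ 1`.  If `D(f)` is free at every prime other than the
irrelevant maximal ideal and `pd_S Ω^1(f) ≤ 1` (where `Ω^1(f) = Hom_S(D(f), S)`), then
`D(f)` is free if and only if every associated prime of `S/J_f` has height exactly `2`. -/
theorem free_iff_jacobian_pure (K : Type) [Field K] [CharZero K] (ℓ : ℕ)
    (f : MvPolynomial (Fin ℓ) K)
    (hf0 : f ≠ 0) (hsq : Squarefree f) (hhom : ∃ d : ℕ, 1 ≤ d ∧ f.IsHomogeneous d)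
    (hloc : ∀ (p : Ideal (MvPolynomial (Fin ℓ) K)) (_ : p.IsPrime),
      p ≠ Ideal.span (Set.range (X : Fin ℓ → MvPolynomial (Fin ℓ) K)) →
      Module.Free (Localization.AtPrime p) (LocalizedModule p.primeCompl (Dlog K ℓ f)))
    (hpd : pdLE (MvPolynomial (Fin ℓ) K)
      (ModuleCat.of (MvPolynomial (Fin ℓ) K)
        (Module.Dual (MvPolynomial (Fin ℓ) K) (Dlog K ℓ f))) 1) :
    Module.Free (MvPolynomial (Fin ℓ) K) (Dlog K ℓ f) ↔
    (∀ (q : Ideal (MvPolynomial (Fin ℓ) K)) (hq : q.IsPrime),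
      q ∈ associatedPrimes (MvPolynomial (Fin ℓ) K)
        (MvPolynomial (Fin ℓ) K ⧸ jacobianIdeal K ℓ f) →
      Order.height (⟨q, hq⟩ : PrimeSpectrum (MvPolynomial (Fin ℓ) K)) = 2) := by
  obtain ⟨d, hd, hf⟩ := hhom
  have hJ := self_mem_jacobian hd hf
  constructor
  · intro hfree q hq hass
    exact pure_of_free hf0 hsq hJ hfree q hq hass
  · intro hpure
    obtain ⟨ι, _, P, hP, hm⟩ := exists_min_pres hf
    match ℓ, f, hf0, hsq, hloc, hpd, hf, hJ, hpure, P, hP, hm with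
    | 0, f, _, _, _, _, _, _, _, _, _, _ => exact Module.Free.of_subsingleton _ _
    | 1, f, _, _, _, _, _, _, _, P, hP, hm =>
      exact free_one (fun s x hs hx => (smul_eq_zero.1 hx).resolve_left hs) P hP hm
    | 2, f, hf0, _, _, _, _, _, _, P, hP, hm => exact free_two hf0 P hP hm
    | n + 3, f, hf0, _, hloc, hpd, _, hJ, hpure, P, hP, hm =>
      have h01 : (⟨0, by omega⟩ : Fin (n + 3)) ≠ ⟨1, by omega⟩ := by simp
      have h02 : (⟨0, by omega⟩ : Fin (n + 3)) ≠ ⟨2, by omega⟩ := by simp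
      have h12 : (⟨1, by omega⟩ : Fin (n + 3)) ≠ ⟨2, by omega⟩ := by simp
      have := Dlog_projective hf0 hJ hloc hpd hpure _ _ _ h01 h02 h12
      exact free_of_projective P hP hm
end
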